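/- Let d ≥ 1, N ≥ 2, and assume Assumptions (U), (G1), (G2) together with the normalization ∑_{i=1}^N U(qᵢ) + ∑_{1≤i<j≤N} G(qᵢ−qⱼ) ≥ 1 for all q ∈ D. There exist constants A₁, A₂, c₁ > 0 and ε₀ ∈ (0,1) such that for every ε ∈ (0,ε₀) there is a constant C₂ > 0 with L_N( A₁·H_N³ + ε·H_N·⟨q,p⟩ − A₂ε² ∑_{1≤i<j≤N} ⟨pᵢ−pⱼ, (qᵢ−qⱼ)/|qᵢ−qⱼ|^{β₁−1}⟩ )(q,p) ≤ −c₁·H_N(q,p)² + C₂ for all (q,p) ∈ X. Here ⟨q,p⟩ = ∑_{i=1}^N ⟨qᵢ,pᵢ⟩. (Inequality (3.22) in the proof of Lemma 3.2) -/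

import Mathlib

open scoped RealInnerProductSpace

/-- The `N`-particle generator `L_N` of the relativistic Langevin dynamics (2.2):
`L_Nφ = ∑ᵢ ⟨pᵢ/√(1+ε|pᵢ|²), ∇_{qᵢ}φ⟩
      + ∑ᵢ ⟨−pᵢ/√(1+ε|pᵢ|²) − ∇U(qᵢ) − ∑_{j≠i}∇G(qᵢ−qⱼ), ∇_{pᵢ}φ⟩ + ∑ᵢ Δ_{pᵢ}φ`. -/
noncomputable def LN {d N : ℕ} (ε : ℝ) (U G : EuclideanSpace ℝ (Fin d) → ℝ)
    (φ : (Fin N → EuclideanSpace ℝ (Fin d)) → (Fin N → EuclideanSpace ℝ (Fin d)) → ℝ)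
    (q p : Fin N → EuclideanSpace ℝ (Fin d)) : ℝ :=
  (∑ i : Fin N,
      ⟪(Real.sqrt (1 + ε * ‖p i‖ ^ 2))⁻¹ • p i,
        gradient (fun x => φ (Function.update q i x) p) (q i)⟫)
    + (∑ i : Fin N,
        ⟪-((Real.sqrt (1 + ε * ‖p i‖ ^ 2))⁻¹ • p i) - gradient U (q i)
            - ∑ j ∈ Finset.univ.filter (fun j => j ≠ i), gradient G (q i - q j),
          gradient (fun x => φ q (Function.update p i x)) (p i)⟫)
    + ∑ i : Fin N, ∑ α : Fin d,
        fderiv ℝ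
          (fun x => fderiv ℝ (fun y => φ q (Function.update p i y)) x
            (EuclideanSpace.single α 1))
          (p i) (EuclideanSpace.single α 1)

/-- The `N`-particle Hamiltonian
`H_N(q,p) = ε∑ᵢU(qᵢ) + ε∑_{i<j}G(qᵢ−qⱼ) + ∑ᵢ√(1+ε|pᵢ|²)`. -/
noncomputable def HN {d N : ℕ} (ε : ℝ) (U G : EuclideanSpace ℝ (Fin d) → ℝ)
    (q p : Fin N → EuclideanSpace ℝ (Fin d)) : ℝ :=
  ε * ∑ i, U (q i)
    + ε * ∑ i : Fin N, ∑ j ∈ Finset.univ.filter (fun j => i < j), G (q i - q j)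
    + ∑ i, Real.sqrt (1 + ε * ‖p i‖ ^ 2)

/-- The relativistic velocity `p / √(1+ε|p|²)`. -/
noncomputable def velocity {d N : ℕ} (ε : ℝ) (p : Fin N → EuclideanSpace ℝ (Fin d)) (i : Fin N) :
    EuclideanSpace ℝ (Fin d) :=
  (Real.sqrt (1 + ε * ‖p i‖ ^ 2))⁻¹ • p i

/-- The momentum component of the drift of the dynamics. -/
noncomputable def momentumDrift {d N : ℕ} (ε : ℝ) (U G : EuclideanSpace ℝ (Fin d) → ℝ)
    (q p : Fin N → EuclideanSpace ℝ (Fin d)) (i : Fin N) : EuclideanSpace ℝ (Fin d) :=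
  -((Real.sqrt (1 + ε * ‖p i‖ ^ 2))⁻¹ • p i) - gradient U (q i)
    - ∑ j ∈ Finset.univ.filter (fun j => j ≠ i), gradient G (q i - q j)

/-- Partial gradients on a finite product recombine to the total derivative. -/
lemma sum_inner_gradient_update {d N : ℕ}
    (f : (Fin N → EuclideanSpace ℝ (Fin d)) → ℝ) (q v : Fin N → EuclideanSpace ℝ (Fin d))
    (hf : DifferentiableAt ℝ f q) {D : ℝ} (hD : HasDerivAt (fun t : ℝ => f (q + t • v)) D 0) :
    ∑ i, ⟪v i, gradient (fun x => f (Function.update q i x)) (q i)⟫ = D := by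
  have h1 : ∀ i, ⟪v i, gradient (fun x => f (Function.update q i x)) (q i)⟫
      = fderiv ℝ f q (Pi.single i (v i)) := by
    intro i
    rw [inner_gradient_right]
    have hu := hasFDerivAt_update (𝕜 := ℝ) (i := i) q (q i)
    have hf' : HasFDerivAt f (fderiv ℝ f q) (Function.update q i (q i)) := by
      rw [Function.update_eq_self]; exact hf.hasFDerivAt
    have := hf'.comp (q i) hu
    have h2 : fderiv ℝ (fun x => f (Function.update q i x)) (q i) = _ := this.fderiv
    rw [h2]
    simp only [ContinuousLinearMap.comp_apply, conj_trivial]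
    congr 1
    ext j
    by_cases hj : j = i
    · subst hj; simp
    · simp [hj]
  rw [Finset.sum_congr rfl fun i _ => h1 i, ← map_sum, Finset.univ_sum_single]
  have hl : HasDerivAt (fun t : ℝ => q + t • v) v 0 := by
    simpa using ((hasDerivAt_id (0 : ℝ)).smul_const v).const_add q
  have hf' : HasFDerivAt f (fderiv ℝ f q) (q + (0 : ℝ) • v) := by
    simpa using hf.hasFDerivAt
  exact (hf'.comp_hasDerivAt (0 : ℝ) hl).unique hD

/-- A second directional derivative in one block, computed along a line. -/
lemma fderiv_fderiv_update_eq {d N : ℕ}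
    (f : (Fin N → EuclideanSpace ℝ (Fin d)) → ℝ) (hf : ContDiff ℝ 2 f)
    (p : Fin N → EuclideanSpace ℝ (Fin d)) (i : Fin N) (e : EuclideanSpace ℝ (Fin d))
    {g : ℝ → ℝ} {D : ℝ}
    (hg : ∀ t : ℝ, HasDerivAt (fun t : ℝ => f (Function.update p i (p i + t • e))) (g t) t)
    (hD : HasDerivAt g D 0) :
    fderiv ℝ (fun x => fderiv ℝ (fun y => f (Function.update p i y)) x e) (p i) e = D := by
  have hF : ContDiff ℝ 2 (fun y => f (Function.update p i y)) :=
    hf.comp (contDiff_update 2 p i)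
  set F := fun y => f (Function.update p i y) with hFdef
  have hl : ∀ t : ℝ, HasDerivAt (fun t : ℝ => p i + t • e) e t := by
    intro t
    simpa using ((hasDerivAt_id t).smul_const e).const_add (p i)
  have h1 : ∀ t : ℝ, g t = fderiv ℝ F (p i + t • e) e := by
    intro t
    exact (hg t).unique (((hF.differentiable (by norm_num) _).hasFDerivAt).comp_hasDerivAt t (hl t))
  have h2 : DifferentiableAt ℝ (fun x => fderiv ℝ F x e) (p i) := by
    have : ContDiff ℝ 1 (fun x => fderiv ℝ F x) := hF.fderiv_right (by norm_num)
    exact ((this.differentiable (by norm_num)) (p i)).clm_apply (differentiableAt_const e)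
  have h3 : HasFDerivAt (fun x => fderiv ℝ F x e) (fderiv ℝ (fun x => fderiv ℝ F x e) (p i))
      (p i + (0 : ℝ) • e) := by simpa using h2.hasFDerivAt
  have h4 := h3.comp_hasDerivAt (0 : ℝ) (hl 0)
  have h5 : g = (fun x => fderiv ℝ F x e) ∘ fun t : ℝ => p i + t • e := by
    funext t; exact h1 t
  rw [h5] at hD
  exact h4.unique hD

/-- The generator computed from derivatives along lines. -/
lemma LN_eq_of_hasDerivAt {d N : ℕ} {ε : ℝ} {U G : EuclideanSpace ℝ (Fin d) → ℝ}
    {φ : (Fin N → EuclideanSpace ℝ (Fin d)) → (Fin N → EuclideanSpace ℝ (Fin d)) → ℝ}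
    {q p : Fin N → EuclideanSpace ℝ (Fin d)}
    (hq : DifferentiableAt ℝ (fun q' => φ q' p) q) (hp : ContDiff ℝ 2 (φ q))
    {Dq Dp : ℝ} {g : Fin N → Fin d → ℝ → ℝ} {D : Fin N → Fin d → ℝ}
    (hDq : HasDerivAt (fun t : ℝ => φ (q + t • velocity ε p) p) Dq 0)
    (hDp : HasDerivAt (fun t : ℝ => φ q (p + t • momentumDrift ε U G q p)) Dp 0)
    (hg : ∀ i α t, HasDerivAt
      (fun t : ℝ => φ q (Function.update p i (p i + t • EuclideanSpace.single α 1))) (g i α t) t)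
    (hD : ∀ i α, HasDerivAt (g i α) (D i α) 0) :
    LN ε U G φ q p = Dq + Dp + ∑ i, ∑ α, D i α := by
  unfold LN
  rw [← sum_inner_gradient_update (fun q' => φ q' p) q _ hq hDq,
    ← sum_inner_gradient_update (φ q) p _ (hp.differentiable (by norm_num) p) hDp]
  congr 1
  refine Finset.sum_congr rfl fun i _ => Finset.sum_congr rfl fun α _ => ?_
  exact fderiv_fderiv_update_eq (φ q) hp p i _ (hg i α) (hD i α)

/-- The sum of `f i j` over the pairs `i < j`. -/
def pairSum {N : ℕ} (f : Fin N → Fin N → ℝ) : ℝ :=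
  ∑ i : Fin N, ∑ j ∈ Finset.univ.filter (fun j => i < j), f i j

lemma pairSum_le_pairSum {N : ℕ} {f g : Fin N → Fin N → ℝ} (h : ∀ i j, i < j → f i j ≤ g i j) :
    pairSum f ≤ pairSum g :=
  Finset.sum_le_sum fun i _ => Finset.sum_le_sum fun j hj => h i j (by simpa using hj)

lemma pairSum_congr {N : ℕ} {f g : Fin N → Fin N → ℝ} (h : ∀ i j, i < j → f i j = g i j) :
    pairSum f = pairSum g :=
  Finset.sum_congr rfl fun i _ => Finset.sum_congr rfl fun j hj => h i j (by simpa using hj)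

lemma pairSum_add {N : ℕ} (f g : Fin N → Fin N → ℝ) :
    pairSum (fun i j => f i j + g i j) = pairSum f + pairSum g := by
  simp [pairSum, Finset.sum_add_distrib]

lemma pairSum_sub {N : ℕ} (f g : Fin N → Fin N → ℝ) :
    pairSum (fun i j => f i j - g i j) = pairSum f - pairSum g := by
  simp [pairSum, Finset.sum_sub_distrib]

lemma pairSum_neg {N : ℕ} (f : Fin N → Fin N → ℝ) :
    pairSum (fun i j => -f i j) = -pairSum f := by
  simp [pairSum, Finset.sum_neg_distrib]

lemma pairSum_mul_left {N : ℕ} (c : ℝ) (f : Fin N → Fin N → ℝ) :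
    pairSum (fun i j => c * f i j) = c * pairSum f := by
  simp [pairSum, Finset.mul_sum]

lemma pairSum_nonneg {N : ℕ} {f : Fin N → Fin N → ℝ} (h : ∀ i j, i < j → 0 ≤ f i j) :
    0 ≤ pairSum f :=
  Finset.sum_nonneg fun i _ => Finset.sum_nonneg fun j hj => h i j (by simpa using hj)

lemma abs_pairSum_le {N : ℕ} {f g : Fin N → Fin N → ℝ} (h : ∀ i j, i < j → |f i j| ≤ g i j) :
    |pairSum f| ≤ pairSum g := by
  rw [abs_le, ← pairSum_neg]
  exact ⟨pairSum_le_pairSum fun i j hij => (abs_le.1 (h i j hij)).1,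
    pairSum_le_pairSum fun i j hij => (abs_le.1 (h i j hij)).2⟩

lemma pairSum_const_le {N : ℕ} {c : ℝ} (hc : 0 ≤ c) :
    pairSum (fun _ _ : Fin N => c) ≤ (N : ℝ) ^ 2 * c := by
  calc pairSum (fun _ _ : Fin N => c) ≤ ∑ _i : Fin N, ∑ _j : Fin N, c :=
        Finset.sum_le_sum fun i _ => Finset.sum_le_sum_of_subset_of_nonneg
          (Finset.filter_subset _ _) fun _ _ _ => hc
    _ = (N : ℝ) ^ 2 * c := by simp; ring

/-- A sum over ordered pairs of distinct indices, folded into a sum over pairs `i < j`. -/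
lemma sum_sum_ne_eq_pairSum {N : ℕ} (f : Fin N → Fin N → ℝ) :
    ∑ i : Fin N, ∑ j ∈ Finset.univ.filter (fun j => j ≠ i), f i j
      = pairSum (fun i j => f i j + f j i) := by
  have h1 : ∀ i j : Fin N, (if j ≠ i then f i j else 0)
      = (if i < j then f i j else 0) + (if j < i then f i j else 0) := by
    intro i j
    rcases lt_trichotomy i j with h | h | h
    · simp [h, h.ne', h.not_gt]
    · simp [h]
    · simp [h, h.ne, h.not_gt]
  rw [pairSum_add]
  simp only [pairSum, Finset.sum_filter, h1, Finset.sum_add_distrib]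
  congr 1
  exact Finset.sum_comm

lemma HasDerivAt.pairSum {N : ℕ} {f : ℝ → Fin N → Fin N → ℝ} {f' : Fin N → Fin N → ℝ} {t : ℝ}
    (h : ∀ i j, i < j → HasDerivAt (fun s => f s i j) (f' i j) t) :
    HasDerivAt (fun s => _root_.pairSum (f s)) (_root_.pairSum f') t := by
  unfold _root_.pairSum
  exact HasDerivAt.fun_sum fun i _ => HasDerivAt.fun_sum fun j hj => h i j (by simpa using hj)

lemma one_le_sqrt_one_add {d : ℕ} {ε : ℝ} (hε : 0 < ε) (x : EuclideanSpace ℝ (Fin d)) :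
    1 ≤ Real.sqrt (1 + ε * ‖x‖ ^ 2) := by
  rw [Real.one_le_sqrt]
  nlinarith [mul_nonneg hε.le (sq_nonneg ‖x‖)]

lemma hasDerivAt_add_smul {F : Type*} [NormedAddCommGroup F] [NormedSpace ℝ F] (x u : F) (t : ℝ) :
    HasDerivAt (fun s : ℝ => x + s • u) u t := by
  simpa using ((hasDerivAt_id t).smul_const u).const_add x

lemma hasDerivAt_sqrt_one_add {d : ℕ} {ε : ℝ} (hε : 0 < ε) (x u : EuclideanSpace ℝ (Fin d))
    (t : ℝ) :
    HasDerivAt (fun s : ℝ => Real.sqrt (1 + ε * ‖x + s • u‖ ^ 2))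
      (ε * ⟪x + t • u, u⟫ / Real.sqrt (1 + ε * ‖x + t • u‖ ^ 2)) t := by
  have h := ((hasDerivAt_add_smul x u t).norm_sq.const_mul ε).const_add 1
  have hpos : 1 + ε * ‖x + t • u‖ ^ 2 ≠ 0 := by
    have := mul_nonneg hε.le (sq_nonneg ‖x + t • u‖)
    positivity
  convert h.sqrt hpos using 1
  field_simp

lemma hasDerivAt_sqrt_one_add_deriv {d : ℕ} {ε : ℝ} (hε : 0 < ε) (x u : EuclideanSpace ℝ (Fin d)) :
    HasDerivAt (fun t : ℝ => ε * ⟪x + t • u, u⟫ / Real.sqrt (1 + ε * ‖x + t • u‖ ^ 2))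
      (ε * ‖u‖ ^ 2 / Real.sqrt (1 + ε * ‖x‖ ^ 2)
        - ε ^ 2 * ⟪x, u⟫ ^ 2 / Real.sqrt (1 + ε * ‖x‖ ^ 2) ^ 3) 0 := by
  have h1 : HasDerivAt (fun t : ℝ => ε * ⟪x + t • u, u⟫) (ε * ‖u‖ ^ 2) 0 := by
    have := ((hasDerivAt_add_smul x u 0).inner ℝ (hasDerivAt_const (0 : ℝ) u)).const_mul ε
    simpa using this
  have h2 := hasDerivAt_sqrt_one_add hε x u 0
  have hS := one_le_sqrt_one_add hε x
  have h3 := h1.div h2 (by simp; positivity)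
  refine h3.congr_deriv ?_
  simp only [zero_smul, add_zero]
  set S := Real.sqrt (1 + ε * ‖x‖ ^ 2)
  have : S ≠ 0 := by positivity
  field_simp

/-- The vector field `x / |x|^γ`. -/
noncomputable def pairForce {d : ℕ} (γ : ℝ) (x : EuclideanSpace ℝ (Fin d)) :
    EuclideanSpace ℝ (Fin d) :=
  (‖x‖ ^ γ)⁻¹ • x

lemma pairForce_neg {d : ℕ} (γ : ℝ) (x : EuclideanSpace ℝ (Fin d)) :
    pairForce γ (-x) = -pairForce γ x := by
  simp [pairForce]

lemma pairForce_eq {d : ℕ} (γ : ℝ) (x : EuclideanSpace ℝ (Fin d)) :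
    pairForce γ x = ((‖x‖ ^ 2) ^ (-γ / 2)) • x := by
  rw [pairForce, ← Real.rpow_natCast, ← Real.rpow_mul (norm_nonneg _),
    ← Real.rpow_neg (norm_nonneg _)]
  congr 2
  push_cast
  ring

lemma differentiableAt_pairForce {d : ℕ} (γ : ℝ) {x : EuclideanSpace ℝ (Fin d)} (hx : x ≠ 0) :
    DifferentiableAt ℝ (pairForce γ) x := by
  have : (pairForce γ : EuclideanSpace ℝ (Fin d) → _) = fun x => ((‖x‖ ^ 2) ^ (-γ / 2)) • x := by
    funext x; exact pairForce_eq γ x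
  rw [this]
  have hx2 : ‖x‖ ^ 2 ≠ 0 := by simpa using hx
  exact ((differentiableAt_id.norm_sq ℝ).rpow_const (Or.inl hx2)).smul differentiableAt_id

lemma exists_hasDerivAt_pairForce {d : ℕ} {γ : ℝ} (hγ0 : 0 ≤ γ) (hγ1 : γ ≤ 1)
    {x : EuclideanSpace ℝ (Fin d)} (hx : x ≠ 0) (u : EuclideanSpace ℝ (Fin d)) :
    ∃ D : EuclideanSpace ℝ (Fin d), HasDerivAt (fun t : ℝ => pairForce γ (x + t • u)) D 0 ∧
      ‖D‖ ≤ 2 * ‖x‖ ^ (-γ) * ‖u‖ := by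
  have h1 := (hasDerivAt_add_smul x u 0).norm_sq
  have hx0 : 0 < ‖x‖ := by simpa using hx
  have hx2 : ‖x + (0 : ℝ) • u‖ ^ 2 ≠ 0 := by simpa using hx
  have h2 := (h1.rpow_const (p := -γ / 2) (Or.inl hx2)).smul (hasDerivAt_add_smul x u 0)
  refine ⟨_, by simp only [pairForce_eq]; exact h2, ?_⟩
  simp only [zero_smul, add_zero]
  have e1 : (‖x‖ ^ 2) ^ (-γ / 2) = ‖x‖ ^ (-γ) := by
    rw [← Real.rpow_natCast, ← Real.rpow_mul (norm_nonneg _)]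
    congr 1; push_cast; ring
  have e2 : (‖x‖ ^ 2) ^ (-γ / 2 - 1) = ‖x‖ ^ (-γ) / ‖x‖ ^ 2 := by
    rw [Real.rpow_sub (by positivity), e1, Real.rpow_one]
  rw [e1, e2]
  have hr : 0 ≤ ‖x‖ ^ (-γ) := by positivity
  calc _ ≤ ‖x‖ ^ (-γ) * ‖u‖ + |2 * ⟪x, u⟫ * (-γ / 2) * (‖x‖ ^ (-γ) / ‖x‖ ^ 2)| * ‖x‖ := by
        refine (norm_add_le _ _).trans ?_
        rw [norm_smul, norm_smul, Real.norm_eq_abs, Real.norm_eq_abs, abs_of_nonneg hr]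
    _ = ‖x‖ ^ (-γ) * ‖u‖ + γ * |⟪x, u⟫| * ‖x‖ ^ (-γ) / ‖x‖ := by
        rw [abs_mul, abs_mul, abs_mul, abs_div, abs_neg, abs_of_nonneg hγ0,
          abs_of_nonneg (by positivity : 0 ≤ ‖x‖ ^ (-γ) / ‖x‖ ^ 2)]
        simp only [Nat.abs_ofNat]
        field_simp
    _ ≤ ‖x‖ ^ (-γ) * ‖u‖ + 1 * (‖x‖ * ‖u‖) * ‖x‖ ^ (-γ) / ‖x‖ := by
        have := abs_real_inner_le_norm x u
        gcongr
    _ = 2 * ‖x‖ ^ (-γ) * ‖u‖ := by field_simp; ring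

section Derivatives

variable {d N : ℕ} {ε : ℝ} {U G : EuclideanSpace ℝ (Fin d) → ℝ}
  {q p : Fin N → EuclideanSpace ℝ (Fin d)}

lemma hasDerivAt_comp_line {f : EuclideanSpace ℝ (Fin d) → ℝ} {x : EuclideanSpace ℝ (Fin d)}
    (hf : DifferentiableAt ℝ f x) (u : EuclideanSpace ℝ (Fin d)) :
    HasDerivAt (fun t : ℝ => f (x + t • u)) ⟪gradient f x, u⟫ 0 := by
  have hf' : HasFDerivAt f (fderiv ℝ f x) (x + (0 : ℝ) • u) := by simpa using hf.hasFDerivAt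
  rw [inner_gradient_left]
  exact hf'.comp_hasDerivAt (0 : ℝ) (hasDerivAt_add_smul x u 0)

lemma hasDerivAt_HN_position (hU : Differentiable ℝ U) (hG : ∀ x, x ≠ 0 → DifferentiableAt ℝ G x)
    (hq : Function.Injective q) (v : Fin N → EuclideanSpace ℝ (Fin d)) :
    HasDerivAt (fun t : ℝ => HN ε U G (q + t • v) p)
      (ε * ∑ i, ⟪gradient U (q i), v i⟫
        + ε * pairSum (fun i j => ⟪gradient G (q i - q j), v i - v j⟫)) 0 := by
  have h1 : HasDerivAt (fun t : ℝ => ∑ i, U ((q + t • v) i)) (∑ i, ⟪gradient U (q i), v i⟫) 0 :=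
    HasDerivAt.fun_sum fun i _ => by simpa using hasDerivAt_comp_line (hU (q i)) (v i)
  have h2 : HasDerivAt (fun t : ℝ => pairSum (fun i j => G ((q + t • v) i - (q + t • v) j)))
      (pairSum (fun i j => ⟪gradient G (q i - q j), v i - v j⟫)) 0 := by
    refine HasDerivAt.pairSum fun i j hij => ?_
    have := hasDerivAt_comp_line (hG _ (sub_ne_zero.2 (hq.ne hij.ne))) (v i - v j)
    have e : ∀ t : ℝ, (q + t • v) i - (q + t • v) j = q i - q j + t • (v i - v j) := by
      intro t
      change (q i + t • v i) - (q j + t • v j) = _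
      module
    simpa only [e] using this
  exact ((h1.const_mul ε).add (h2.const_mul ε)).add_const _

lemma hasDerivAt_HN_momentum (hε : 0 < ε) (b : Fin N → EuclideanSpace ℝ (Fin d)) :
    HasDerivAt (fun t : ℝ => HN ε U G q (p + t • b)) (ε * ∑ i, ⟪velocity ε p i, b i⟫) 0 := by
  have h1 : HasDerivAt (fun t : ℝ => ∑ i, Real.sqrt (1 + ε * ‖(p + t • b) i‖ ^ 2))
      (∑ i, ε * ⟪velocity ε p i, b i⟫) 0 := by
    refine HasDerivAt.fun_sum fun i _ => ?_
    refine (hasDerivAt_sqrt_one_add hε (p i) (b i) 0).congr_deriv ?_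
    simp only [velocity, zero_smul, add_zero, inner_smul_left, conj_trivial]
    ring
  rw [Finset.mul_sum]
  exact h1.const_add _

lemma hasDerivAt_HN_update (hε : 0 < ε) (i : Fin N) (e : EuclideanSpace ℝ (Fin d)) (t : ℝ) :
    HasDerivAt (fun t : ℝ => HN ε U G q (Function.update p i (p i + t • e)))
      (ε * ⟪p i + t • e, e⟫ / Real.sqrt (1 + ε * ‖p i + t • e‖ ^ 2)) t := by
  have h1 : HasDerivAt (fun t : ℝ => ∑ k, Real.sqrt (1 + ε *
      ‖Function.update p i (p i + t • e) k‖ ^ 2))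
      (∑ k, if k = i then ε * ⟪p i + t • e, e⟫ / Real.sqrt (1 + ε * ‖p i + t • e‖ ^ 2) else 0)
      t := by
    refine HasDerivAt.fun_sum fun k _ => ?_
    by_cases hk : k = i
    · subst hk
      simpa using hasDerivAt_sqrt_one_add hε (p k) e t
    · simpa [hk] using hasDerivAt_const t (Real.sqrt (1 + ε * ‖p k‖ ^ 2))
  rw [Finset.sum_ite_eq' Finset.univ i] at h1
  simp only [Finset.mem_univ, if_true] at h1
  exact h1.const_add _

lemma contDiff_HN_momentum (hε : 0 < ε) : ContDiff ℝ 2 (HN ε U G q) := by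
  unfold HN
  refine contDiff_const.add (ContDiff.sum fun i _ => ?_)
  refine ContDiff.sqrt ?_ fun p => ?_
  · exact contDiff_const.add (contDiff_const.mul ((contDiff_apply ℝ _ i).norm_sq ℝ))
  · have := mul_nonneg hε.le (sq_nonneg ‖p i‖)
    positivity

lemma differentiableAt_HN_position (hU : Differentiable ℝ U)
    (hG : ∀ x, x ≠ 0 → DifferentiableAt ℝ G x) (hq : Function.Injective q) :
    DifferentiableAt ℝ (fun q' => HN ε U G q' p) q := by
  unfold HN
  have hap : ∀ i, DifferentiableAt ℝ (fun q' : Fin N → EuclideanSpace ℝ (Fin d) => q' i) q :=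
    fun i => differentiableAt_apply i q
  refine ((DifferentiableAt.const_mul ?_ ε).add (DifferentiableAt.const_mul ?_ ε)).add_const _
  · exact DifferentiableAt.fun_sum fun i _ =>
      DifferentiableAt.comp (g := U) q (hU (q i)) (hap i)
  · refine DifferentiableAt.fun_sum fun i _ => DifferentiableAt.fun_sum fun j hj => ?_
    have hij : i < j := by simpa using hj
    exact DifferentiableAt.comp (g := G) q (hG _ (sub_ne_zero.2 (hq.ne hij.ne)))
      ((hap i).sub (hap j))

end Derivatives

section Lyapunov

variable {d N : ℕ} {ε : ℝ} {U G : EuclideanSpace ℝ (Fin d) → ℝ}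
  {q p : Fin N → EuclideanSpace ℝ (Fin d)}

/-- The sum over pairs of `⟨pᵢ-pⱼ, w(qᵢ-qⱼ)⟩` with `w(x) = x/|x|^γ`. -/
noncomputable def pairVirial {d N : ℕ} (γ : ℝ) (q p : Fin N → EuclideanSpace ℝ (Fin d)) : ℝ :=
  pairSum fun i j => ⟪p i - p j, pairForce γ (q i - q j)⟫

lemma exists_hasDerivAt_pairVirial {γ : ℝ} (hγ0 : 0 ≤ γ) (hγ1 : γ ≤ 1)
    (hq : Function.Injective q) (p v : Fin N → EuclideanSpace ℝ (Fin d)) :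
    ∃ D : ℝ, HasDerivAt (fun t : ℝ => pairVirial γ (q + t • v) p) D 0 ∧
      |D| ≤ pairSum fun i j => ‖p i - p j‖ * (2 * ‖q i - q j‖ ^ (-γ) * ‖v i - v j‖) := by
  have h : ∀ i j : Fin N, ∃ D : EuclideanSpace ℝ (Fin d), i < j →
      HasDerivAt (fun t : ℝ => pairForce γ (q i - q j + t • (v i - v j))) D 0 ∧
      ‖D‖ ≤ 2 * ‖q i - q j‖ ^ (-γ) * ‖v i - v j‖ := by
    intro i j
    by_cases hij : i < j
    · obtain ⟨D, hD⟩ := exists_hasDerivAt_pairForce hγ0 hγ1 (sub_ne_zero.2 (hq.ne hij.ne))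
        (v i - v j)
      exact ⟨D, fun _ => hD⟩
    · exact ⟨0, fun h => absurd h hij⟩
  choose D hD using h
  have e : ∀ (t : ℝ) i j, (q + t • v) i - (q + t • v) j = q i - q j + t • (v i - v j) := by
    intro t i j
    change (q i + t • v i) - (q j + t • v j) = _
    module
  refine ⟨pairSum fun i j => ⟪p i - p j, D i j⟫, ?_, ?_⟩
  · simp only [pairVirial, e]
    refine HasDerivAt.pairSum fun i j hij => ?_
    have := (hasDerivAt_const (0 : ℝ) (p i - p j)).inner ℝ (hD i j hij).1
    simpa using this
  · refine abs_pairSum_le fun i j hij => (abs_real_inner_le_norm _ _).trans ?_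
    exact mul_le_mul_of_nonneg_left (hD i j hij).2 (norm_nonneg _)

lemma pairVirial_line (γ : ℝ) (q p b : Fin N → EuclideanSpace ℝ (Fin d)) (t : ℝ) :
    pairVirial γ q (p + t • b) = pairVirial γ q p + t * pairVirial γ q b := by
  unfold pairVirial
  rw [← pairSum_mul_left, ← pairSum_add]
  refine pairSum_congr fun i j _ => ?_
  have e : (p + t • b) i - (p + t • b) j = p i - p j + t • (b i - b j) := by
    change (p i + t • b i) - (p j + t • b j) = _
    module
  rw [e, inner_add_left, inner_smul_left]
  simp

lemma update_add_smul (p : Fin N → EuclideanSpace ℝ (Fin d)) (i : Fin N)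
    (e : EuclideanSpace ℝ (Fin d)) (t : ℝ) :
    Function.update p i (p i + t • e) = p + t • (Pi.single i e : Fin N → EuclideanSpace ℝ (Fin d)) := by
  funext k
  by_cases hk : k = i
  · subst hk
    change _ = p k + t • (Pi.single k e : Fin N → EuclideanSpace ℝ (Fin d)) k
    simp
  · change _ = p k + t • (Pi.single i e : Fin N → EuclideanSpace ℝ (Fin d)) k
    simp [hk]

lemma contDiff_pairVirial (γ : ℝ) (q : Fin N → EuclideanSpace ℝ (Fin d)) :
    ContDiff ℝ 2 (pairVirial γ q) := by
  unfold pairVirial pairSum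
  exact ContDiff.sum fun i _ => ContDiff.sum fun j _ =>
    ((contDiff_apply ℝ _ i).sub (contDiff_apply ℝ _ j)).inner ℝ contDiff_const

lemma differentiableAt_pairVirial (γ : ℝ) (hq : Function.Injective q)
    (p : Fin N → EuclideanSpace ℝ (Fin d)) :
    DifferentiableAt ℝ (fun q' => pairVirial γ q' p) q := by
  unfold pairVirial pairSum
  refine DifferentiableAt.fun_sum fun i _ => DifferentiableAt.fun_sum fun j hj => ?_
  have hij : i < j := by simpa using hj
  refine (differentiableAt_const _).inner ℝ ?_
  exact DifferentiableAt.comp (g := pairForce γ) q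
    (differentiableAt_pairForce γ (sub_ne_zero.2 (hq.ne hij.ne)))
    ((differentiableAt_apply i q).sub (differentiableAt_apply j q))

lemma sum_inner_line_right (q p b : Fin N → EuclideanSpace ℝ (Fin d)) (t : ℝ) :
    ∑ i, ⟪q i, (p + t • b) i⟫ = ∑ i, ⟪q i, p i⟫ + t * ∑ i, ⟪q i, b i⟫ := by
  rw [Finset.mul_sum, ← Finset.sum_add_distrib]
  refine Finset.sum_congr rfl fun i _ => ?_
  change ⟪q i, p i + t • b i⟫ = _
  rw [inner_add_right, inner_smul_right]

/-- The Lyapunov candidate `A₁H³ + εH⟨q,p⟩ - A₂ε²⟨⟨p,w⟩⟩`. -/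
noncomputable def lyapunov {d N : ℕ} (A₁ A₂ γ ε : ℝ) (U G : EuclideanSpace ℝ (Fin d) → ℝ)
    (q p : Fin N → EuclideanSpace ℝ (Fin d)) : ℝ :=
  A₁ * (HN ε U G q p) ^ 3 + ε * HN ε U G q p * (∑ i, ⟪q i, p i⟫)
    - A₂ * ε ^ 2 * pairVirial γ q p

lemma hasDerivAt_lyapunov_comp {A₁ A₂ ε t : ℝ} {h b m : ℝ → ℝ} {h' b' m' : ℝ}
    (hh : HasDerivAt h h' t) (hb : HasDerivAt b b' t) (hm : HasDerivAt m m' t) :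
    HasDerivAt (fun s => A₁ * h s ^ 3 + ε * h s * b s - A₂ * ε ^ 2 * m s)
      (3 * A₁ * h t ^ 2 * h' + ε * (h' * b t + h t * b') - A₂ * ε ^ 2 * m') t := by
  refine ((((hh.pow 3).const_mul A₁).add ((hh.const_mul ε).mul hb)).sub
    (hm.const_mul (A₂ * ε ^ 2))).congr_deriv ?_
  push_cast
  ring

lemma hasDerivAt_lyapunov_deriv_comp {A₁ A₂ ε t : ℝ} {h b h' : ℝ → ℝ} {h'' b' m' : ℝ}
    (hh : HasDerivAt h (h' t) t) (hb : HasDerivAt b b' t) (hh' : HasDerivAt h' h'' t) :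
    HasDerivAt (fun s => 3 * A₁ * h s ^ 2 * h' s + ε * (h' s * b s + h s * b') - A₂ * ε ^ 2 * m')
      (3 * A₁ * h t ^ 2 * h'' + 6 * A₁ * h t * h' t ^ 2 + ε * (h'' * b t + 2 * h' t * b')) t := by
  refine (((((hh.pow 2).const_mul (3 * A₁)).mul hh').add
    (((hh'.mul hb).add (hh.mul_const b')).const_mul ε)).sub_const _).congr_deriv ?_
  push_cast
  simp only [Pi.pow_apply]
  ring

lemma sum_inner_single_sq (x : EuclideanSpace ℝ (Fin d)) :
    ∑ α, ⟪x, EuclideanSpace.single α (1 : ℝ)⟫ ^ 2 = ‖x‖ ^ 2 := by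
  simp [EuclideanSpace.norm_sq_eq, EuclideanSpace.inner_single_right]

lemma sum_inner_single_mul (x y : EuclideanSpace ℝ (Fin d)) :
    ∑ α, ⟪x, EuclideanSpace.single α (1 : ℝ)⟫ * ⟪y, EuclideanSpace.single α (1 : ℝ)⟫ = ⟪x, y⟫ := by
  simp [PiLp.inner_apply, mul_comm]

lemma norm_velocity (hε : 0 < ε) (p : Fin N → EuclideanSpace ℝ (Fin d)) (i : Fin N) :
    ‖velocity ε p i‖ = ‖p i‖ / Real.sqrt (1 + ε * ‖p i‖ ^ 2) := by
  have := one_le_sqrt_one_add hε (p i)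
  rw [velocity, norm_smul, norm_inv, Real.norm_of_nonneg (by positivity)]
  ring

/-- The generator applied to the Hamiltonian. -/
noncomputable def generatorHN {d N : ℕ} (ε : ℝ) (p : Fin N → EuclideanSpace ℝ (Fin d)) : ℝ :=
  -(ε * ∑ i, ‖velocity ε p i‖ ^ 2)
    + ∑ i, (ε * d / Real.sqrt (1 + ε * ‖p i‖ ^ 2)
        - ε ^ 2 * ‖p i‖ ^ 2 / Real.sqrt (1 + ε * ‖p i‖ ^ 2) ^ 3)

lemma inner_momentumDrift_sum (hGodd : ∀ x, x ≠ 0 → gradient G (-x) = -gradient G x)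
    (hq : Function.Injective q) (z : Fin N → EuclideanSpace ℝ (Fin d)) :
    ∑ i, ⟪z i, momentumDrift ε U G q p i⟫ = -∑ i, ⟪z i, velocity ε p i⟫
      - ∑ i, ⟪gradient U (q i), z i⟫ - pairSum (fun i j => ⟪gradient G (q i - q j), z i - z j⟫) := by
  have h : pairSum (fun i j => ⟪gradient G (q i - q j), z i - z j⟫)
      = ∑ i : Fin N, ∑ j ∈ Finset.univ.filter (fun j => j ≠ i), ⟪z i, gradient G (q i - q j)⟫ := by
    rw [sum_sum_ne_eq_pairSum]
    refine pairSum_congr fun i j hij => ?_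
    rw [← neg_sub (q i) (q j), hGodd _ (sub_ne_zero.2 (hq.ne hij.ne)), inner_sub_right,
      inner_neg_right, real_inner_comm, real_inner_comm (z j)]
    ring
  rw [h, ← Finset.sum_neg_distrib, ← Finset.sum_sub_distrib, ← Finset.sum_sub_distrib]
  refine Finset.sum_congr rfl fun i _ => ?_
  rw [momentumDrift, inner_sub_right, inner_sub_right, inner_neg_right, inner_sum, velocity,
    real_inner_comm (z i) (gradient U (q i))]

lemma LN_lyapunov_eq (hε : 0 < ε) (hU : Differentiable ℝ U)
    (hG : ∀ x, x ≠ 0 → DifferentiableAt ℝ G x)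
    (hGodd : ∀ x, x ≠ 0 → gradient G (-x) = -gradient G x) (hq : Function.Injective q)
    {A₁ A₂ γ : ℝ} (hγ0 : 0 ≤ γ) (hγ1 : γ ≤ 1) :
    ∃ D : ℝ,
      |D| ≤ pairSum (fun i j => ‖p i - p j‖ *
        (2 * ‖q i - q j‖ ^ (-γ) * ‖velocity ε p i - velocity ε p j‖)) ∧
      LN ε U G (lyapunov A₁ A₂ γ ε U G) q p =
        (3 * A₁ * HN ε U G q p ^ 2 + ε * ∑ i, ⟪q i, p i⟫) * generatorHN ε p
        + 6 * A₁ * HN ε U G q p * ε ^ 2 * ∑ i, ‖velocity ε p i‖ ^ 2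
        + 2 * ε ^ 2 * ∑ i, ⟪velocity ε p i, q i⟫
        + ε * HN ε U G q p * (∑ i, ⟪velocity ε p i, p i⟫ + ∑ i, ⟪q i, momentumDrift ε U G q p i⟫)
        - A₂ * ε ^ 2 * (D + pairVirial γ q (momentumDrift ε U G q p)) := by
  set v := velocity ε p with hv
  set b := momentumDrift ε U G q p with hb
  obtain ⟨D, hD, hDle⟩ := exists_hasDerivAt_pairVirial hγ0 hγ1 hq p v
  refine ⟨D, hDle, ?_⟩
  have hdiff : DifferentiableAt ℝ (fun q' => lyapunov A₁ A₂ γ ε U G q' p) q := by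
    have h1 := differentiableAt_HN_position (ε := ε) (p := p) hU hG hq
    have h2 : DifferentiableAt ℝ (fun q' : Fin N → EuclideanSpace ℝ (Fin d) =>
        ∑ i, ⟪q' i, p i⟫) q :=
      DifferentiableAt.fun_sum fun i _ =>
        (differentiableAt_apply i q).inner ℝ (differentiableAt_const (p i))
    exact (((h1.pow 3).const_mul A₁).add ((h1.const_mul ε).mul h2)).sub
      ((differentiableAt_pairVirial γ hq p).const_mul (A₂ * ε ^ 2))
  have hcd : ContDiff ℝ 2 (lyapunov A₁ A₂ γ ε U G q) := by
    have h1 := contDiff_HN_momentum (U := U) (G := G) (q := q) hε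
    have h2 : ContDiff ℝ 2 (fun p' : Fin N → EuclideanSpace ℝ (Fin d) => ∑ i, ⟪q i, p' i⟫) :=
      ContDiff.sum fun i _ => contDiff_const.inner ℝ (contDiff_apply ℝ _ i)
    exact ((contDiff_const.mul (h1.pow 3)).add ((contDiff_const.mul h1).mul h2)).sub
      (contDiff_const.mul (contDiff_pairVirial γ q))
  have hBq : HasDerivAt (fun t : ℝ => ∑ i, ⟪(q + t • v) i, p i⟫) (∑ i, ⟪v i, p i⟫) 0 := by
    refine HasDerivAt.fun_sum fun i _ => ?_
    have := (hasDerivAt_add_smul (q i) (v i) 0).inner ℝ (hasDerivAt_const (0 : ℝ) (p i))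
    simpa using this
  have hline : ∀ a c t : ℝ, HasDerivAt (fun s : ℝ => a + s * c) c t := by
    intro a c t
    simpa using ((hasDerivAt_id t).mul_const c).const_add a
  have hBp : ∀ (z : Fin N → EuclideanSpace ℝ (Fin d)) (t : ℝ),
      HasDerivAt (fun t : ℝ => ∑ i, ⟪q i, (p + t • z) i⟫) (∑ i, ⟪q i, z i⟫) t := by
    intro z t
    simp only [sum_inner_line_right]
    exact hline _ _ t
  have hMp : ∀ (z : Fin N → EuclideanSpace ℝ (Fin d)) (t : ℝ),
      HasDerivAt (fun t : ℝ => pairVirial γ q (p + t • z)) (pairVirial γ q z) t := by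
    intro z t
    simp only [pairVirial_line]
    exact hline _ _ t
  have hBu : ∀ i (e : EuclideanSpace ℝ (Fin d)) (t : ℝ), HasDerivAt
      (fun t : ℝ => ∑ k, ⟪q k, Function.update p i (p i + t • e) k⟫)
      (∑ k, ⟪q k, (Pi.single i e : Fin N → EuclideanSpace ℝ (Fin d)) k⟫) t := by
    intro i e t
    simpa only [update_add_smul] using hBp (Pi.single i e) t
  have hMu : ∀ i (e : EuclideanSpace ℝ (Fin d)) (t : ℝ), HasDerivAt
      (fun t : ℝ => pairVirial γ q (Function.update p i (p i + t • e)))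
      (pairVirial γ q (Pi.single i e)) t := by
    intro i e t
    simpa only [update_add_smul] using hMp (Pi.single i e) t
  have key := LN_eq_of_hasDerivAt (U := U) (G := G) hdiff hcd
    (hasDerivAt_lyapunov_comp (hasDerivAt_HN_position hU hG hq v) hBq hD)
    (hasDerivAt_lyapunov_comp (hasDerivAt_HN_momentum hε b) (hBp b 0) (hMp b 0))
    (fun i α t => hasDerivAt_lyapunov_comp
      (hasDerivAt_HN_update (p := p) hε i (EuclideanSpace.single α 1) t)
      (hBu i _ t) (hMu i _ t))
    (fun i α => hasDerivAt_lyapunov_deriv_comp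
      (hasDerivAt_HN_update (p := p) hε i (EuclideanSpace.single α 1) 0)
      (hBu i _ 0)
      (hasDerivAt_sqrt_one_add_deriv hε (p i) (EuclideanSpace.single α 1)))
  rw [key]
  simp only [zero_smul, add_zero, Function.update_eq_self]
  have hlap : ∀ i, ∑ α, (3 * A₁ * HN ε U G q p ^ 2 *
        (ε * ‖(EuclideanSpace.single α 1 : EuclideanSpace ℝ (Fin d))‖ ^ 2 /
            Real.sqrt (1 + ε * ‖p i‖ ^ 2)
          - ε ^ 2 * ⟪p i, EuclideanSpace.single α 1⟫ ^ 2 / Real.sqrt (1 + ε * ‖p i‖ ^ 2) ^ 3)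
      + 6 * A₁ * HN ε U G q p *
        (ε * ⟪p i, EuclideanSpace.single α 1⟫ / Real.sqrt (1 + ε * ‖p i‖ ^ 2)) ^ 2
      + ε * ((ε * ‖(EuclideanSpace.single α 1 : EuclideanSpace ℝ (Fin d))‖ ^ 2 /
            Real.sqrt (1 + ε * ‖p i‖ ^ 2)
          - ε ^ 2 * ⟪p i, EuclideanSpace.single α 1⟫ ^ 2 / Real.sqrt (1 + ε * ‖p i‖ ^ 2) ^ 3)
          * ∑ i, ⟪q i, p i⟫
        + 2 * (ε * ⟪p i, EuclideanSpace.single α 1⟫ / Real.sqrt (1 + ε * ‖p i‖ ^ 2))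
          * ∑ k, ⟪q k, (Pi.single i (EuclideanSpace.single α 1) :
              Fin N → EuclideanSpace ℝ (Fin d)) k⟫))
      = (3 * A₁ * HN ε U G q p ^ 2 + ε * ∑ i, ⟪q i, p i⟫) *
          (ε * d / Real.sqrt (1 + ε * ‖p i‖ ^ 2)
            - ε ^ 2 * ‖p i‖ ^ 2 / Real.sqrt (1 + ε * ‖p i‖ ^ 2) ^ 3)
        + 6 * A₁ * HN ε U G q p * ε ^ 2 * ‖v i‖ ^ 2 + 2 * ε ^ 2 * ⟪v i, q i⟫ := by
    intro i
    have hS := one_le_sqrt_one_add hε (p i)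
    have hs : ∀ α, ∑ k, ⟪q k, (Pi.single i (EuclideanSpace.single α 1) :
        Fin N → EuclideanSpace ℝ (Fin d)) k⟫ = ⟪q i, EuclideanSpace.single α (1 : ℝ)⟫ := by
      intro α
      rw [Finset.sum_eq_single i]
      · simp
      · intro k _ hk
        simp [hk]
      · simp
    simp only [hs]
    rw [hv, norm_velocity hε, velocity, inner_smul_left, conj_trivial, div_pow]
    generalize Real.sqrt (1 + ε * ‖p i‖ ^ 2) = S at hS
    generalize HN ε U G q p = H
    generalize ∑ i, ⟪q i, p i⟫ = B
    rw [← sum_inner_single_sq (p i), ← sum_inner_single_mul (p i) (q i)]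
    have hd : (d : ℝ) = ∑ _α : Fin d, (1 : ℝ) := by simp
    rw [hd]
    simp only [Finset.mul_sum, Finset.sum_div, ← Finset.sum_sub_distrib, ← Finset.sum_add_distrib]
    refine Finset.sum_congr rfl fun α _ => ?_
    have : ‖(EuclideanSpace.single α 1 : EuclideanSpace ℝ (Fin d))‖ = 1 := by simp
    rw [this]
    field_simp
    ring
  rw [Finset.sum_congr rfl fun i _ => hlap i, Finset.sum_add_distrib, Finset.sum_add_distrib,
    ← Finset.mul_sum, ← Finset.mul_sum, ← Finset.mul_sum]
  have hvb := inner_momentumDrift_sum (U := U) (ε := ε) (p := p) hGodd hq v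
  have hvv : ∑ i, ⟪v i, velocity ε p i⟫ = ∑ i, ‖v i‖ ^ 2 :=
    Finset.sum_congr rfl fun i _ => real_inner_self_eq_norm_sq (v i)
  rw [hvv, ← hb] at hvb
  rw [hvb, generatorHN, ← hv]
  ring

end Lyapunov

section Triangle

/-- A cyclic inequality for the side lengths of a triangle. -/
lemma triangle_cubic_nonneg {a b c : ℝ} (ha : a ≤ b + c) (hb : b ≤ a + c) (hc : c ≤ a + b) :
    0 ≤ (b ^ 2 + c ^ 2 - a ^ 2) * (b ^ 2 + c ^ 2) * a ^ 3
      + (a ^ 2 + c ^ 2 - b ^ 2) * (a ^ 2 + c ^ 2) * b ^ 3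
      + (a ^ 2 + b ^ 2 - c ^ 2) * (a ^ 2 + b ^ 2) * c ^ 3 := by
  obtain ⟨x, hx⟩ : ∃ x, x = (b + c - a) / 2 := ⟨_, rfl⟩
  obtain ⟨y, hy⟩ : ∃ y, y = (a + c - b) / 2 := ⟨_, rfl⟩
  obtain ⟨z, hz⟩ : ∃ z, z = (a + b - c) / 2 := ⟨_, rfl⟩
  have hx0 : 0 ≤ x := by linarith
  have hy0 : 0 ≤ y := by linarith
  have hz0 : 0 ≤ z := by linarith
  obtain rfl : a = y + z := by linarith
  obtain rfl : b = x + z := by linarith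
  obtain rfl : c = x + y := by linarith
  have key : 0 ≤ 4 * (x ^ 4 * y ^ 3 + x ^ 4 * z ^ 3 + x ^ 3 * y ^ 4 + x ^ 3 * z ^ 4
        + y ^ 4 * z ^ 3 + y ^ 3 * z ^ 4)
      + 8 * (x * y * z ^ 5 + x * y ^ 5 * z + x ^ 5 * y * z)
      + 32 * (x ^ 4 * y ^ 2 * z + x ^ 4 * y * z ^ 2 + x ^ 2 * y ^ 4 * z + x ^ 2 * y * z ^ 4
        + x * y ^ 4 * z ^ 2 + x * y ^ 2 * z ^ 4)
      + 56 * (x ^ 3 * y ^ 3 * z + x ^ 3 * y * z ^ 3 + x * y ^ 3 * z ^ 3)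
      + 120 * (x ^ 3 * y ^ 2 * z ^ 2 + x ^ 2 * y ^ 3 * z ^ 2 + x ^ 2 * y ^ 2 * z ^ 3) := by
    positivity
  refine key.trans (le_of_eq ?_)
  ring

lemma triangle_rpow_nonneg_of_le {a b c μ : ℝ} (ha0 : 0 < a) (hb0 : 0 < b) (hac : a ≤ c)
    (hbc : b ≤ c) (hc : c ≤ a + b) (hμ : μ ≤ 3) :
    0 ≤ (b ^ 2 + c ^ 2 - a ^ 2) * (b ^ 2 + c ^ 2) * a ^ μ
      + (a ^ 2 + c ^ 2 - b ^ 2) * (a ^ 2 + c ^ 2) * b ^ μ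
      + (a ^ 2 + b ^ 2 - c ^ 2) * (a ^ 2 + b ^ 2) * c ^ μ := by
  have hc0 : 0 < c := ha0.trans_le hac
  have hsplit : ∀ x : ℝ, 0 < x → x ^ μ = x ^ (μ - 3) * x ^ 3 := by
    intro x hx
    rw [← Real.rpow_natCast x 3, ← Real.rpow_add hx]
    congr 1; push_cast; ring
  have hmono : ∀ x : ℝ, 0 < x → x ≤ c → c ^ (μ - 3) * x ^ 3 ≤ x ^ μ := by
    intro x hx hxc
    rw [hsplit x hx]
    have := Real.rpow_le_rpow_of_nonpos hx hxc (by linarith : μ - 3 ≤ 0)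
    gcongr
  have hca : 0 ≤ b ^ 2 + c ^ 2 - a ^ 2 := by nlinarith [sq_nonneg b]
  have hcb : 0 ≤ a ^ 2 + c ^ 2 - b ^ 2 := by nlinarith [sq_nonneg a]
  have h3 := mul_nonneg (Real.rpow_nonneg hc0.le (μ - 3))
    (triangle_cubic_nonneg (a := a) (b := b) (c := c) (by linarith) (by linarith) hc)
  have h1 := mul_le_mul_of_nonneg_left (hmono a ha0 hac)
    (mul_nonneg hca (by positivity : 0 ≤ b ^ 2 + c ^ 2))
  have h2 := mul_le_mul_of_nonneg_left (hmono b hb0 hbc)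
    (mul_nonneg hcb (by positivity : 0 ≤ a ^ 2 + c ^ 2))
  rw [hsplit c hc0]
  linarith

lemma triangle_rpow_nonneg {a b c μ : ℝ} (ha0 : 0 < a) (hb0 : 0 < b) (hc0 : 0 < c)
    (ha : a ≤ b + c) (hb : b ≤ a + c) (hc : c ≤ a + b) (hμ : μ ≤ 3) :
    0 ≤ (b ^ 2 + c ^ 2 - a ^ 2) * (b ^ 2 + c ^ 2) * a ^ μ
      + (a ^ 2 + c ^ 2 - b ^ 2) * (a ^ 2 + c ^ 2) * b ^ μ
      + (a ^ 2 + b ^ 2 - c ^ 2) * (a ^ 2 + b ^ 2) * c ^ μ := by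
  by_cases h1 : a ≤ c ∧ b ≤ c
  · exact triangle_rpow_nonneg_of_le ha0 hb0 h1.1 h1.2 hc hμ
  by_cases h2 : a ≤ b ∧ c ≤ b
  · have := triangle_rpow_nonneg_of_le ha0 hc0 h2.1 h2.2 hb hμ
    linarith
  · have hba : b ≤ a ∧ c ≤ a := by
      constructor <;> by_contra! h <;> by_cases hbc : b ≤ c
      · exact h1 ⟨h.le.trans hbc, hbc⟩
      · exact h2 ⟨h.le, (not_le.1 hbc).le⟩
      · exact h1 ⟨h.le, hbc⟩
      · exact h2 ⟨h.le.trans (not_le.1 hbc).le, (not_le.1 hbc).le⟩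
    have := triangle_rpow_nonneg_of_le hb0 hc0 hba.1 hba.2 ha hμ
    linarith

lemma inner_pairForce_add_swap {d : ℕ} (γ : ℝ) {u w : EuclideanSpace ℝ (Fin d)} (hu : u ≠ 0)
    (hw : w ≠ 0) :
    ⟪pairForce (γ + 2) u, pairForce γ w⟫ + ⟪pairForce (γ + 2) w, pairForce γ u⟫
      = (‖u‖ ^ 2 + ‖w‖ ^ 2 - ‖u - w‖ ^ 2) * (‖u‖ ^ 2 + ‖w‖ ^ 2)
        * ((‖u‖ ^ (γ + 2) * ‖w‖ ^ (γ + 2))⁻¹ / 2) := by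
  have hu0 : 0 < ‖u‖ := norm_pos_iff.2 hu
  have hw0 : 0 < ‖w‖ := norm_pos_iff.2 hw
  have e : ∀ x : ℝ, 0 < x → x ^ (γ + 2) = x ^ γ * x ^ 2 := by
    intro x hx
    rw [Real.rpow_add hx]; norm_num
  have h1 : ‖u - w‖ ^ 2 = ‖u‖ ^ 2 - 2 * ⟪u, w⟫ + ‖w‖ ^ 2 := norm_sub_sq_real u w
  simp only [pairForce, inner_smul_left, inner_smul_right, conj_trivial]
  rw [h1, e _ hu0, e _ hw0, real_inner_comm u w]
  have := Real.rpow_pos_of_pos hu0 γ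
  have := Real.rpow_pos_of_pos hw0 γ
  field_simp
  ring

lemma sum_triangle_pairForce_nonneg {d : ℕ} {γ : ℝ} (hγ1 : γ ≤ 1)
    {x y z : EuclideanSpace ℝ (Fin d)} (hxy : x ≠ y) (hxz : x ≠ z) (hyz : y ≠ z) :
    0 ≤ (⟪pairForce (γ + 2) (x - y), pairForce γ (x - z)⟫
          + ⟪pairForce (γ + 2) (x - z), pairForce γ (x - y)⟫)
      + (⟪pairForce (γ + 2) (y - x), pairForce γ (y - z)⟫
          + ⟪pairForce (γ + 2) (y - z), pairForce γ (y - x)⟫)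
      + (⟪pairForce (γ + 2) (z - x), pairForce γ (z - y)⟫
          + ⟪pairForce (γ + 2) (z - y), pairForce γ (z - x)⟫) := by
  rw [inner_pairForce_add_swap γ (sub_ne_zero.2 hxy) (sub_ne_zero.2 hxz),
    inner_pairForce_add_swap γ (sub_ne_zero.2 hxy.symm) (sub_ne_zero.2 hyz),
    inner_pairForce_add_swap γ (sub_ne_zero.2 hxz.symm) (sub_ne_zero.2 hyz.symm)]
  simp only [sub_sub_sub_cancel_left]
  rw [norm_sub_rev y x, norm_sub_rev z x, norm_sub_rev z y]
  have ha0 : 0 < ‖y - z‖ := norm_pos_iff.2 (sub_ne_zero.2 hyz)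
  have hb0 : 0 < ‖x - z‖ := norm_pos_iff.2 (sub_ne_zero.2 hxz)
  have hc0 : 0 < ‖x - y‖ := norm_pos_iff.2 (sub_ne_zero.2 hxy)
  have ha : ‖y - z‖ ≤ ‖x - z‖ + ‖x - y‖ := by
    have := norm_sub_le_norm_sub_add_norm_sub y x z
    rw [norm_sub_rev y x] at this; linarith
  have hb : ‖x - z‖ ≤ ‖y - z‖ + ‖x - y‖ := by
    have := norm_sub_le_norm_sub_add_norm_sub x y z
    linarith
  have hc : ‖x - y‖ ≤ ‖y - z‖ + ‖x - z‖ := by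
    have := norm_sub_le_norm_sub_add_norm_sub x z y
    rw [norm_sub_rev z y] at this; linarith
  have key := triangle_rpow_nonneg ha0 hb0 hc0 ha hb hc (by linarith : γ + 2 ≤ 3)
  set a := ‖y - z‖
  set b := ‖x - z‖
  set c := ‖x - y‖
  have hap := Real.rpow_pos_of_pos ha0 (γ + 2)
  have hbp := Real.rpow_pos_of_pos hb0 (γ + 2)
  have hcp := Real.rpow_pos_of_pos hc0 (γ + 2)
  refine (mul_nonneg (by positivity : 0 ≤
    (a ^ (γ + 2) * b ^ (γ + 2) * c ^ (γ + 2))⁻¹ / 2) key).trans (le_of_eq ?_)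
  field_simp
  ring

lemma sum_sum_sum_nonneg_of_symm {ι : Type*} [Fintype ι] (f : ι → ι → ι → ℝ)
    (h : ∀ i j k, 0 ≤ f i j k + f i k j + (f j i k + f j k i) + (f k i j + f k j i)) :
    0 ≤ ∑ i, ∑ j, ∑ k, f i j k := by
  have e1 : ∑ i, ∑ j, ∑ k, f i k j = ∑ i, ∑ j, ∑ k, f i j k :=
    Finset.sum_congr rfl fun i _ => Finset.sum_comm
  have e2 : ∑ i, ∑ j, ∑ k, f j i k = ∑ i, ∑ j, ∑ k, f i j k := Finset.sum_comm
  have e3 : ∑ i, ∑ j, ∑ k, f j k i = ∑ i, ∑ j, ∑ k, f i j k := by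
    rw [← e1, Finset.sum_comm]
  have e4 : ∑ i, ∑ j, ∑ k, f k i j = ∑ i, ∑ j, ∑ k, f i j k := by
    rw [← e2]
    exact Finset.sum_congr rfl fun i _ => Finset.sum_comm
  have e5 : ∑ i, ∑ j, ∑ k, f k j i = ∑ i, ∑ j, ∑ k, f i j k := by
    rw [← e3]
    exact Finset.sum_congr rfl fun i _ => Finset.sum_comm
  have h6 : 0 ≤ ∑ i, ∑ j, ∑ k,
      (f i j k + f i k j + (f j i k + f j k i) + (f k i j + f k j i)) :=
    Finset.sum_nonneg fun i _ => Finset.sum_nonneg fun j _ => Finset.sum_nonneg fun k _ => h i j k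
  simp only [Finset.sum_add_distrib] at h6
  linarith

lemma inner_pairForce_self {d : ℕ} (γ : ℝ) {u : EuclideanSpace ℝ (Fin d)} (hu : u ≠ 0) :
    ⟪pairForce (γ + 2) u, pairForce γ u⟫ = (‖u‖ ^ (-γ)) ^ 2 := by
  have hu0 : 0 < ‖u‖ := norm_pos_iff.2 hu
  have := Real.rpow_pos_of_pos hu0 γ
  have e : ‖u‖ ^ (γ + 2) = ‖u‖ ^ γ * ‖u‖ ^ 2 := by
    rw [Real.rpow_add hu0]; norm_num
  simp only [pairForce, inner_smul_left, inner_smul_right, conj_trivial,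
    real_inner_self_eq_norm_sq]
  rw [e, Real.rpow_neg hu0.le]
  field_simp

lemma pairForce_zero {d : ℕ} (γ : ℝ) : pairForce γ (0 : EuclideanSpace ℝ (Fin d)) = 0 := by
  simp [pairForce]

lemma pairVirial_eq_sum {d N : ℕ} (γ : ℝ) (q f : Fin N → EuclideanSpace ℝ (Fin d)) :
    pairVirial γ q f = ∑ i, ∑ j, ⟪f i, pairForce γ (q i - q j)⟫ := by
  have h : ∀ i : Fin N, ∑ j, ⟪f i, pairForce γ (q i - q j)⟫
      = ∑ j ∈ Finset.univ.filter (fun j => j ≠ i), ⟪f i, pairForce γ (q i - q j)⟫ := by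
    intro i
    refine (Finset.sum_filter_of_ne fun j _ hj => ?_).symm
    rintro rfl
    simp [pairForce_zero] at hj
  rw [Finset.sum_congr rfl fun i _ => h i, sum_sum_ne_eq_pairSum]
  refine pairSum_congr fun i j _ => ?_
  rw [← neg_sub (q i) (q j), pairForce_neg, inner_neg_right, inner_sub_left]
  ring

/-- The many-body repulsion is at least as dissipative as its two-body part. -/
lemma two_mul_pairSum_le_pairVirial {d N : ℕ} {γ : ℝ} (hγ1 : γ ≤ 1)
    {q : Fin N → EuclideanSpace ℝ (Fin d)} (hq : Function.Injective q) :
    2 * pairSum (fun i j => (‖q i - q j‖ ^ (-γ)) ^ 2)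
      ≤ pairVirial γ q (fun i => ∑ k ∈ Finset.univ.filter (fun k => k ≠ i),
          pairForce (γ + 2) (q i - q k)) := by
  have hF : ∀ i : Fin N, ∑ k ∈ Finset.univ.filter (fun k => k ≠ i), pairForce (γ + 2) (q i - q k)
      = ∑ k, pairForce (γ + 2) (q i - q k) := by
    intro i
    refine Finset.sum_filter_of_ne fun j _ hj => ?_
    rintro rfl
    simp [pairForce_zero] at hj
  set T : Fin N → Fin N → Fin N → ℝ := fun i j k =>
    ⟪pairForce (γ + 2) (q i - q k), pairForce γ (q i - q j)⟫ with hT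
  have hoff : 0 ≤ ∑ i, ∑ j, ∑ k, (if j = k then 0 else T i j k) := by
    refine sum_sum_sum_nonneg_of_symm _ fun i j k => ?_
    by_cases hij : i = j
    · subst hij
      by_cases hik : i = k
      · subst hik; simp
      · simp [hik, Ne.symm hik, hT, pairForce_zero]
    by_cases hik : i = k
    · subst hik
      simp [hij, Ne.symm hij, hT, pairForce_zero]
    by_cases hjk : j = k
    · subst hjk
      simp [hij, hT, pairForce_zero]
    have := sum_triangle_pairForce_nonneg hγ1 (hq.ne hij) (hq.ne hik) (hq.ne hjk)
    simp only [hT, hij, hik, hjk, Ne.symm hij, Ne.symm hik, Ne.symm hjk, if_false]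
    linarith
  have hdiag : ∑ i, ∑ j, T i j j = 2 * pairSum (fun i j => (‖q i - q j‖ ^ (-γ)) ^ 2) := by
    have h : ∀ i : Fin N, ∑ j, T i j j
        = ∑ j ∈ Finset.univ.filter (fun j => j ≠ i), (‖q i - q j‖ ^ (-γ)) ^ 2 := by
      intro i
      rw [← Finset.sum_filter_of_ne (p := fun j => j ≠ i)]
      · refine Finset.sum_congr rfl fun j hj => ?_
        have hji : j ≠ i := by simpa using hj
        exact inner_pairForce_self γ (sub_ne_zero.2 (hq.ne hji.symm))
      · rintro j _ hj rfl
        simp [hT, pairForce_zero] at hj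
    rw [Finset.sum_congr rfl fun i _ => h i, sum_sum_ne_eq_pairSum, ← pairSum_mul_left]
    refine pairSum_congr fun i j _ => ?_
    rw [norm_sub_rev (q j)]
    ring
  have hsplit : ∀ i j : Fin N, ∑ k, T i j k = T i j j + ∑ k, (if j = k then 0 else T i j k) := by
    intro i j
    have : ∀ k, T i j k = (if j = k then T i j k else 0) + (if j = k then 0 else T i j k) := by
      intro k; split_ifs <;> simp
    rw [Finset.sum_congr rfl fun k _ => this k, Finset.sum_add_distrib]
    simp
  rw [pairVirial_eq_sum]
  simp only [hF, sum_inner]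
  change _ ≤ ∑ i, ∑ j, ∑ k, T i j k
  simp only [hsplit, Finset.sum_add_distrib]
  rw [hdiag]
  simpa using hoff

end Triangle

section Potential

variable {d : ℕ} {G : EuclideanSpace ℝ (Fin d) → ℝ}

lemma exists_neg_mul_le_of_tendsto_atTop {a β : ℝ} (ha : 0 < a) (hβ : 0 < β)
    (hblow : Filter.Tendsto G (nhdsWithin 0 {(0 : EuclideanSpace ℝ (Fin d))}ᶜ) Filter.atTop)
    (hbd : ∀ x : EuclideanSpace ℝ (Fin d), x ≠ 0 → |G x| ≤ a * (1 + ‖x‖ + ‖x‖ ^ (-β))) :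
    ∃ C : ℝ, 0 ≤ C ∧ ∀ x, x ≠ 0 → -(C * (1 + ‖x‖)) ≤ G x := by
  have h := hblow.eventually (Filter.eventually_ge_atTop 0)
  rw [eventually_nhdsWithin_iff, Metric.eventually_nhds_iff] at h
  obtain ⟨δ, hδ, h⟩ := h
  have hδp := Real.rpow_pos_of_pos hδ (-β)
  refine ⟨a * (1 + δ ^ (-β)), by positivity, fun x hx => ?_⟩
  by_cases hxδ : ‖x‖ < δ
  · have := h (y := x) (by simpa using hxδ) (by simpa using hx)
    have : 0 ≤ a * (1 + δ ^ (-β)) * (1 + ‖x‖) := by positivity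
    linarith
  · push Not at hxδ
    have h1 : ‖x‖ ^ (-β) ≤ δ ^ (-β) := Real.rpow_le_rpow_of_nonpos hδ hxδ (by linarith)
    have h2 := (abs_le.1 (hbd x hx)).1
    have h3 : a * (1 + ‖x‖ + ‖x‖ ^ (-β)) ≤ a * (1 + δ ^ (-β)) * (1 + ‖x‖) := by
      rw [mul_assoc]
      refine mul_le_mul_of_nonneg_left ?_ ha.le
      nlinarith [norm_nonneg x]
    linarith

/-- Integrating the bound on the gradient radially improves the bound on the potential near `0`. -/
lemma le_of_norm_gradient_le {a γ : ℝ} (ha : 0 < a) (hγ : 0 < γ)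
    (hG : ∀ x, x ≠ 0 → DifferentiableAt ℝ G x)
    (hbd : ∀ x : EuclideanSpace ℝ (Fin d), x ≠ 0 → |G x| ≤ a * (1 + ‖x‖ + ‖x‖ ^ (-(γ + 1))))
    (hgrad : ∀ x : EuclideanSpace ℝ (Fin d), x ≠ 0 →
      ‖gradient G x‖ ≤ a * (1 + ‖x‖ ^ (-(γ + 1))))
    (x : EuclideanSpace ℝ (Fin d)) (hx : x ≠ 0) :
    G x ≤ (3 * a + 2 * a / γ) * (1 + ‖x‖ + ‖x‖ ^ (-γ)) := by
  have hx0 : 0 < ‖x‖ := norm_pos_iff.2 hx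
  have hp := Real.rpow_pos_of_pos hx0 (-γ)
  have hK : 0 < 2 * a / γ := by positivity
  by_cases hx1 : 1 ≤ ‖x‖
  · have h1 : ‖x‖ ^ (-(γ + 1)) ≤ 1 := Real.rpow_le_one_of_one_le_of_nonpos hx1 (by linarith)
    have h2 := (abs_le.1 (hbd x hx)).2
    nlinarith [mul_pos ha hp, mul_pos hK hp, mul_pos hK hx0, mul_pos ha hx0]
  · push Not at hx1
    obtain ⟨e, he⟩ : ∃ e : EuclideanSpace ℝ (Fin d), e = ‖x‖⁻¹ • x := ⟨_, rfl⟩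
    have hen : ‖e‖ = 1 := by rw [he, norm_smul, norm_inv, norm_norm, inv_mul_cancel₀ hx0.ne']
    have hxe : ‖x‖ • e = x := by rw [he, smul_smul, mul_inv_cancel₀ hx0.ne', one_smul]
    have hder : ∀ s : ℝ, 0 < s → HasDerivAt (fun s : ℝ => G (s • e) - 2 * a / γ * s ^ (-γ))
        (⟪gradient G (s • e), e⟫ - 2 * a / γ * (-γ * s ^ (-γ - 1))) s := by
      intro s hs
      have hse : s • e ≠ 0 := by
        rw [← norm_pos_iff, norm_smul, hen, mul_one]; simpa using hs.ne'
      have h1 : HasDerivAt (fun s : ℝ => G (s • e)) ⟪gradient G (s • e), e⟫ s := by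
        rw [inner_gradient_left]
        have h2 : HasDerivAt (fun s : ℝ => s • e) e s := by
          simpa using (hasDerivAt_id s).smul_const e
        exact (hG _ hse).hasFDerivAt.comp_hasDerivAt s h2
      exact h1.sub ((Real.hasDerivAt_rpow_const (Or.inl hs.ne')).const_mul _)
    have hmono : MonotoneOn (fun s : ℝ => G (s • e) - 2 * a / γ * s ^ (-γ)) (Set.Icc ‖x‖ 1) := by
      refine monotoneOn_of_deriv_nonneg (convex_Icc _ _) (fun s hs =>
        (hder s (hx0.trans_le hs.1)).continuousAt.continuousWithinAt) (fun s hs => ?_) fun s hs => ?_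
      · rw [interior_Icc] at hs
        exact (hder s (hx0.trans hs.1)).differentiableAt.differentiableWithinAt
      · rw [interior_Icc] at hs
        have hs0 := hx0.trans hs.1
        have hns : ‖s • e‖ = s := by rw [norm_smul, hen, mul_one, Real.norm_of_nonneg hs0.le]
        have hse : s • e ≠ 0 := by rw [← norm_pos_iff, hns]; exact hs0
        rw [(hder s hs0).deriv]
        have h1 := hgrad _ hse
        rw [hns] at h1
        have h2 := abs_le.1 (abs_real_inner_le_norm (gradient G (s • e)) e)
        rw [hen, mul_one] at h2
        have h3 : 1 ≤ s ^ (-(γ + 1)) :=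
          Real.one_le_rpow_of_pos_of_le_one_of_nonpos hs0 hs.2.le (by linarith)
        have h4 : 2 * a / γ * (-γ * s ^ (-γ - 1)) = -(2 * a * s ^ (-(γ + 1))) := by
          rw [show -γ - 1 = -(γ + 1) by ring]; field_simp
        rw [h4]
        nlinarith [h2.1]
    have h := hmono ⟨le_rfl, hx1.le⟩ ⟨hx1.le, le_rfl⟩ hx1.le
    simp only [hxe, one_smul, Real.one_rpow, mul_one] at h
    have h2 := (abs_le.1 (hbd e (by rw [← norm_pos_iff, hen]; norm_num))).2
    rw [hen, Real.one_rpow] at h2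
    nlinarith [mul_pos ha hp, mul_pos hK hx0, mul_pos ha hx0]

/-- The singular part of the pair interaction force is `a₄ x / |x|^{γ+2}`, up to lower order. -/
lemma exists_norm_gradient_add_pairForce_le {a₄ a₅ a₆ γ β : ℝ} (ha₆ : 0 ≤ a₆) (hβ0 : 0 ≤ β)
    (hβγ : β ≤ γ)
    (h : ∀ x : EuclideanSpace ℝ (Fin d), x ≠ 0 →
      ‖gradient G x + (a₄ / ‖x‖ ^ (γ + 2)) • x + (a₅ / ‖x‖ ^ (β + 1)) • x‖ ≤ a₆) :
    ∃ C : ℝ, 0 ≤ C ∧ ∀ x, x ≠ 0 →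
      ‖gradient G x + a₄ • pairForce (γ + 2) x‖ ≤ C * (1 + ‖x‖ ^ (-γ)) := by
  refine ⟨|a₅| + a₆, by positivity, fun x hx => ?_⟩
  have hx0 : 0 < ‖x‖ := norm_pos_iff.2 hx
  have e1 : a₄ • pairForce (γ + 2) x = (a₄ / ‖x‖ ^ (γ + 2)) • x := by
    rw [pairForce, smul_smul, div_eq_mul_inv]
  have e2 : ‖(a₅ / ‖x‖ ^ (β + 1)) • x‖ = |a₅| * ‖x‖ ^ (-β) := by
    rw [norm_smul, norm_div, Real.norm_eq_abs, Real.norm_of_nonneg (by positivity),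
      Real.rpow_add hx0, Real.rpow_neg hx0.le, Real.rpow_one]
    field_simp
  have h1 : ‖x‖ ^ (-β) ≤ 1 + ‖x‖ ^ (-γ) := by
    have hp := Real.rpow_pos_of_pos hx0 (-γ)
    rcases le_total ‖x‖ 1 with hx1 | hx1
    · linarith [Real.rpow_le_rpow_of_exponent_ge hx0 hx1 (by linarith : -γ ≤ -β)]
    · linarith [Real.rpow_le_one_of_one_le_of_nonpos hx1 (by linarith : -β ≤ 0)]
  have hp := Real.rpow_pos_of_pos hx0 (-γ)
  calc ‖gradient G x + a₄ • pairForce (γ + 2) x‖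
      = ‖(gradient G x + (a₄ / ‖x‖ ^ (γ + 2)) • x + (a₅ / ‖x‖ ^ (β + 1)) • x)
          - (a₅ / ‖x‖ ^ (β + 1)) • x‖ := by rw [e1]; congr 1; abel
    _ ≤ a₆ + |a₅| * ‖x‖ ^ (-β) := (norm_sub_le _ _).trans (by rw [e2]; linarith [h x hx])
    _ ≤ (|a₅| + a₆) * (1 + ‖x‖ ^ (-γ)) := by
        nlinarith [mul_le_mul_of_nonneg_left h1 (abs_nonneg a₅), mul_nonneg ha₆ hp.le]

end Potential

section Momentum

variable {d N : ℕ} {ε : ℝ}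

lemma mul_norm_velocity_sq (hε : 0 < ε) (p : Fin N → EuclideanSpace ℝ (Fin d)) (i : Fin N) :
    ε * ‖velocity ε p i‖ ^ 2 = 1 - (Real.sqrt (1 + ε * ‖p i‖ ^ 2) ^ 2)⁻¹ := by
  have h : 0 < 1 + ε * ‖p i‖ ^ 2 := by positivity
  rw [norm_velocity hε, div_pow, Real.sq_sqrt h.le]
  field_simp
  ring

lemma sqrt_mul_norm_velocity_le (hε : 0 < ε) (p : Fin N → EuclideanSpace ℝ (Fin d)) (i : Fin N) :
    Real.sqrt ε * ‖velocity ε p i‖ ≤ 1 := by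
  have h := mul_norm_velocity_sq hε p i
  have h2 : (Real.sqrt ε * ‖velocity ε p i‖) ^ 2 ≤ 1 := by
    rw [mul_pow, Real.sq_sqrt hε.le, h]
    have : 0 ≤ (Real.sqrt (1 + ε * ‖p i‖ ^ 2) ^ 2)⁻¹ := by positivity
    linarith
  exact (sq_le_one_iff₀ (by positivity)).1 h2

lemma sqrt_mul_norm_le_sqrt_one_add (hε : 0 < ε) (x : EuclideanSpace ℝ (Fin d)) :
    Real.sqrt ε * ‖x‖ ≤ Real.sqrt (1 + ε * ‖x‖ ^ 2) := by
  refine Real.le_sqrt_of_sq_le ?_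
  rw [mul_pow, Real.sq_sqrt hε.le]
  linarith

lemma mul_inner_velocity_self (hε : 0 < ε) (p : Fin N → EuclideanSpace ℝ (Fin d)) (i : Fin N) :
    ε * ⟪velocity ε p i, p i⟫
      = Real.sqrt (1 + ε * ‖p i‖ ^ 2) * (ε * ‖velocity ε p i‖ ^ 2) := by
  have h : 0 < Real.sqrt (1 + ε * ‖p i‖ ^ 2) := by positivity
  rw [norm_velocity hε, velocity, inner_smul_left, real_inner_self_eq_norm_sq, conj_trivial]
  field_simp

lemma mul_norm_velocity_sq_le_one (hε : 0 < ε) (p : Fin N → EuclideanSpace ℝ (Fin d)) (i : Fin N) :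
    ε * ‖velocity ε p i‖ ^ 2 ≤ 1 := by
  rw [mul_norm_velocity_sq hε]
  have : 0 ≤ (Real.sqrt (1 + ε * ‖p i‖ ^ 2) ^ 2)⁻¹ := by positivity
  linarith

lemma mul_sum_norm_velocity_sq_le (hε : 0 < ε) (p : Fin N → EuclideanSpace ℝ (Fin d)) :
    ε * ∑ i, ‖velocity ε p i‖ ^ 2 ≤ N := by
  rw [Finset.mul_sum]
  calc ∑ i, ε * ‖velocity ε p i‖ ^ 2 ≤ ∑ _i : Fin N, (1 : ℝ) :=
        Finset.sum_le_sum fun i _ => mul_norm_velocity_sq_le_one hε p i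
    _ = N := by simp

lemma generatorHN_le (hε : 0 < ε) (p : Fin N → EuclideanSpace ℝ (Fin d)) :
    generatorHN ε p ≤ -(ε * ∑ i, ‖velocity ε p i‖ ^ 2) + ε * d * N := by
  have h : ∑ i, (ε * d / Real.sqrt (1 + ε * ‖p i‖ ^ 2)
      - ε ^ 2 * ‖p i‖ ^ 2 / Real.sqrt (1 + ε * ‖p i‖ ^ 2) ^ 3) ≤ ∑ _i : Fin N, ε * d := by
    refine Finset.sum_le_sum fun i _ => ?_
    have h1 : ε * d / Real.sqrt (1 + ε * ‖p i‖ ^ 2) ≤ ε * d :=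
      div_le_self (by positivity) (one_le_sqrt_one_add hε _)
    have h2 : 0 ≤ ε ^ 2 * ‖p i‖ ^ 2 / Real.sqrt (1 + ε * ‖p i‖ ^ 2) ^ 3 := by positivity
    linarith
  rw [Finset.sum_const, Finset.card_univ, Fintype.card_fin, nsmul_eq_mul] at h
  unfold generatorHN
  linarith

lemma abs_generatorHN_le (hε : 0 < ε) (hε1 : ε ≤ 1) (p : Fin N → EuclideanSpace ℝ (Fin d)) :
    |generatorHN ε p| ≤ N * (d + 2) := by
  have h0 : 0 ≤ ε * ∑ i, ‖velocity ε p i‖ ^ 2 := by positivity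
  have h1 := mul_sum_norm_velocity_sq_le hε p
  have h2 := generatorHN_le hε p
  have h3 : ∑ _i : Fin N, (-1 : ℝ) ≤ ∑ i, (ε * d / Real.sqrt (1 + ε * ‖p i‖ ^ 2)
      - ε ^ 2 * ‖p i‖ ^ 2 / Real.sqrt (1 + ε * ‖p i‖ ^ 2) ^ 3) := by
    refine Finset.sum_le_sum fun i _ => ?_
    have hS := one_le_sqrt_one_add hε (p i)
    have h1 : ε ^ 2 * ‖p i‖ ^ 2 / Real.sqrt (1 + ε * ‖p i‖ ^ 2) ^ 3 ≤ 1 := by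
      rw [div_le_one (by positivity), pow_succ (Real.sqrt _), Real.sq_sqrt (by positivity)]
      have : ε ^ 2 * ‖p i‖ ^ 2 ≤ ε * ‖p i‖ ^ 2 :=
        mul_le_mul_of_nonneg_right (by nlinarith) (by positivity)
      nlinarith [mul_nonneg hε.le (sq_nonneg ‖p i‖)]
    have h2 : 0 ≤ ε * d / Real.sqrt (1 + ε * ‖p i‖ ^ 2) := by positivity
    linarith
  rw [Finset.sum_const, Finset.card_univ, Fintype.card_fin, nsmul_eq_mul] at h3
  have h4 : ε * d * N ≤ d * N := by
    have : (0 : ℝ) ≤ d * N := by positivity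
    nlinarith
  have hN : (0 : ℝ) ≤ N := by positivity
  rw [abs_le]
  constructor
  · unfold generatorHN
    nlinarith [mul_nonneg hN (Nat.cast_nonneg' d : (0 : ℝ) ≤ d)]
  · linarith

lemma sum_sqrt_one_add_le (hε : 0 < ε) {H : ℝ} (p : Fin N → EuclideanSpace ℝ (Fin d))
    (hH : ∀ i, Real.sqrt (1 + ε * ‖p i‖ ^ 2) ≤ H) :
    ∑ i, Real.sqrt (1 + ε * ‖p i‖ ^ 2) ≤ H * (ε * ∑ i, ‖velocity ε p i‖ ^ 2) + N := by
  calc ∑ i, Real.sqrt (1 + ε * ‖p i‖ ^ 2)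
      ≤ ∑ i, (H * (ε * ‖velocity ε p i‖ ^ 2) + 1) := Finset.sum_le_sum fun i _ => by
        have h1 := one_le_sqrt_one_add hε (p i)
        have h2 := mul_norm_velocity_sq hε p i
        have h3 : 0 ≤ ε * ‖velocity ε p i‖ ^ 2 := by positivity
        have h4 := mul_le_mul_of_nonneg_right (hH i) h3
        have h5 : Real.sqrt (1 + ε * ‖p i‖ ^ 2) * (ε * ‖velocity ε p i‖ ^ 2)
            = Real.sqrt (1 + ε * ‖p i‖ ^ 2) - (Real.sqrt (1 + ε * ‖p i‖ ^ 2))⁻¹ := by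
          rw [h2]; field_simp
        linarith [inv_le_one_of_one_le₀ h1]
    _ = _ := by simp [Finset.sum_add_distrib, Finset.mul_sum]

lemma sum_sqrt_one_add_sq_le (hε : 0 < ε) {H : ℝ} (p : Fin N → EuclideanSpace ℝ (Fin d))
    (hH : ∀ i, Real.sqrt (1 + ε * ‖p i‖ ^ 2) ≤ H) :
    (∑ i, Real.sqrt (1 + ε * ‖p i‖ ^ 2)) ^ 2
      ≤ N * (H ^ 2 * (ε * ∑ i, ‖velocity ε p i‖ ^ 2) + N) := by
  have h := sq_sum_le_card_mul_sum_sq (s := (Finset.univ : Finset (Fin N)))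
    (f := fun i => Real.sqrt (1 + ε * ‖p i‖ ^ 2))
  rw [Finset.card_univ, Fintype.card_fin] at h
  refine h.trans (mul_le_mul_of_nonneg_left ?_ (by positivity))
  calc ∑ i, Real.sqrt (1 + ε * ‖p i‖ ^ 2) ^ 2
      ≤ ∑ i, (H ^ 2 * (ε * ‖velocity ε p i‖ ^ 2) + 1) := Finset.sum_le_sum fun i _ => by
        have h1 := one_le_sqrt_one_add hε (p i)
        have h2 := mul_norm_velocity_sq hε p i
        have h3 : 0 ≤ ε * ‖velocity ε p i‖ ^ 2 := by positivity
        have h4 := mul_le_mul_of_nonneg_right (pow_le_pow_left₀ (by positivity) (hH i) 2) h3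
        have h5 : Real.sqrt (1 + ε * ‖p i‖ ^ 2) ^ 2 * (ε * ‖velocity ε p i‖ ^ 2)
            = Real.sqrt (1 + ε * ‖p i‖ ^ 2) ^ 2 - 1 := by
          rw [h2]; field_simp
        linarith
    _ = _ := by simp [Finset.sum_add_distrib, Finset.mul_sum]

lemma mul_sum_inner_velocity_le (hε : 0 < ε) {H : ℝ} (p : Fin N → EuclideanSpace ℝ (Fin d))
    (hH : ∀ i, Real.sqrt (1 + ε * ‖p i‖ ^ 2) ≤ H) :
    ε * ∑ i, ⟪velocity ε p i, p i⟫ ≤ H * (ε * ∑ i, ‖velocity ε p i‖ ^ 2) := by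
  simp only [Finset.mul_sum]
  refine Finset.sum_le_sum fun i _ => ?_
  rw [mul_inner_velocity_self hε]
  exact mul_le_mul_of_nonneg_right (hH i) (by positivity)

lemma sqrt_mul_abs_sum_inner_velocity_le (hε : 0 < ε) (q p : Fin N → EuclideanSpace ℝ (Fin d)) :
    Real.sqrt ε * |∑ i, ⟪q i, velocity ε p i⟫| ≤ ∑ i, ‖q i‖ := by
  calc Real.sqrt ε * |∑ i, ⟪q i, velocity ε p i⟫|
      ≤ Real.sqrt ε * ∑ i, |⟪q i, velocity ε p i⟫| := by
        gcongr; exact Finset.abs_sum_le_sum_abs _ _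
    _ = ∑ i, Real.sqrt ε * |⟪q i, velocity ε p i⟫| := Finset.mul_sum _ _ _
    _ ≤ ∑ i, ‖q i‖ := Finset.sum_le_sum fun i _ => by
        have h1 := mul_le_mul_of_nonneg_left (abs_real_inner_le_norm (q i) (velocity ε p i))
          (Real.sqrt_nonneg ε)
        have h2 := mul_le_mul_of_nonneg_left (sqrt_mul_norm_velocity_le hε p i) (norm_nonneg (q i))
        linarith

lemma mul_abs_sum_inner_le (hε : 0 < ε) {H : ℝ} (q p : Fin N → EuclideanSpace ℝ (Fin d))
    (hH : ∀ i, Real.sqrt (1 + ε * ‖p i‖ ^ 2) ≤ H) :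
    ε * |∑ i, ⟪q i, p i⟫| ≤ Real.sqrt ε * (∑ i, ‖q i‖) * H := by
  calc ε * |∑ i, ⟪q i, p i⟫|
      ≤ ε * ∑ i, |⟪q i, p i⟫| := by
        gcongr; exact Finset.abs_sum_le_sum_abs _ _
    _ = ∑ i, ε * |⟪q i, p i⟫| := Finset.mul_sum _ _ _
    _ ≤ ∑ i, Real.sqrt ε * ‖q i‖ * H := Finset.sum_le_sum fun i _ => by
        have h1 := mul_le_mul_of_nonneg_left (abs_real_inner_le_norm (q i) (p i)) hε.le
        have h2 := mul_le_mul_of_nonneg_left ((sqrt_mul_norm_le_sqrt_one_add hε (p i)).trans (hH i))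
          (by positivity : 0 ≤ Real.sqrt ε * ‖q i‖)
        have h3 : Real.sqrt ε * ‖q i‖ * (Real.sqrt ε * ‖p i‖) = ε * (‖q i‖ * ‖p i‖) := by
          rw [← Real.mul_self_sqrt hε.le]
          rw [Real.sqrt_mul_self (Real.sqrt_nonneg _)]; ring
        linarith
    _ = _ := by rw [Finset.mul_sum, Finset.sum_mul]

lemma mul_abs_le_sum_sqrt_mul_pairSum (hε : 0 < ε) {γ D : ℝ}
    (q p : Fin N → EuclideanSpace ℝ (Fin d))
    (hD : |D| ≤ pairSum (fun i j => ‖p i - p j‖ *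
      (2 * ‖q i - q j‖ ^ (-γ) * ‖velocity ε p i - velocity ε p j‖))) :
    ε * |D| ≤ 4 * ((∑ i, Real.sqrt (1 + ε * ‖p i‖ ^ 2))
      * pairSum (fun i j => ‖q i - q j‖ ^ (-γ))) := by
  calc ε * |D| ≤ ε * pairSum (fun i j => ‖p i - p j‖ *
        (2 * ‖q i - q j‖ ^ (-γ) * ‖velocity ε p i - velocity ε p j‖)) := by gcongr
    _ ≤ pairSum (fun i j => (4 * ∑ i, Real.sqrt (1 + ε * ‖p i‖ ^ 2)) * ‖q i - q j‖ ^ (-γ)) := by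
        rw [← pairSum_mul_left]
        refine pairSum_le_pairSum fun i j hij => ?_
        have h1 : Real.sqrt (1 + ε * ‖p i‖ ^ 2) + Real.sqrt (1 + ε * ‖p j‖ ^ 2)
            ≤ ∑ i, Real.sqrt (1 + ε * ‖p i‖ ^ 2) := by
          rw [← Finset.sum_pair (f := fun i => Real.sqrt (1 + ε * ‖p i‖ ^ 2)) hij.ne]
          exact Finset.sum_le_sum_of_subset_of_nonneg (Finset.subset_univ _)
            fun _ _ _ => Real.sqrt_nonneg _
        have h2 : Real.sqrt ε * ‖p i - p j‖ ≤ ∑ i, Real.sqrt (1 + ε * ‖p i‖ ^ 2) := by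
          have := mul_le_mul_of_nonneg_left (norm_sub_le (p i) (p j)) (Real.sqrt_nonneg ε)
          linarith [sqrt_mul_norm_le_sqrt_one_add hε (p i), sqrt_mul_norm_le_sqrt_one_add hε (p j)]
        have h3 : Real.sqrt ε * ‖velocity ε p i - velocity ε p j‖ ≤ 2 := by
          have := mul_le_mul_of_nonneg_left (norm_sub_le (velocity ε p i) (velocity ε p j))
            (Real.sqrt_nonneg ε)
          linarith [sqrt_mul_norm_velocity_le hε p i, sqrt_mul_norm_velocity_le hε p j]
        have h4 := mul_le_mul h2 h3 (by positivity)
          ((by positivity : 0 ≤ Real.sqrt ε * ‖p i - p j‖).trans h2)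
        have h5 := mul_le_mul_of_nonneg_right h4
          (by positivity : 0 ≤ 2 * ‖q i - q j‖ ^ (-γ))
        have h6 := Real.mul_self_sqrt hε.le
        calc ε * (‖p i - p j‖ * (2 * ‖q i - q j‖ ^ (-γ) * ‖velocity ε p i - velocity ε p j‖))
            = Real.sqrt ε * ‖p i - p j‖ * (Real.sqrt ε * ‖velocity ε p i - velocity ε p j‖)
              * (2 * ‖q i - q j‖ ^ (-γ)) := by
              nth_rewrite 1 [← h6]; ring
          _ ≤ _ := h5
          _ = _ := by ring
    _ = _ := by rw [pairSum_mul_left]; ring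

end Momentum

lemma mul_le_sq_add_sq {α : ℝ} (hα : 0 < α) (c x y : ℝ) :
    c * (x * y) ≤ α * x ^ 2 + c ^ 2 / (4 * α) * y ^ 2 := by
  have h : α * x ^ 2 + c ^ 2 / (4 * α) * y ^ 2 - c * (x * y) = α * (x - c / (2 * α) * y) ^ 2 := by
    field_simp
    ring
  nlinarith [mul_nonneg hα.le (sq_nonneg (x - c / (2 * α) * y))]

set_option maxHeartbeats 1000000 in
/-- The scalar optimization closing the Lyapunov estimate: the constants can be chosen so that every
indefinite term is absorbed. -/
lemma exists_lyapunov_constants {a₁ a₂ a₃ a₄ C₅ C₇ C₈ CU CY Cξ n δ : ℝ} (ha₁ : 0 < a₁)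
    (ha₂ : 0 < a₂) (ha₄ : 0 < a₄) (hC₅ : 0 ≤ C₅) (hC₇ : 0 ≤ C₇) (hC₈ : 0 ≤ C₈)
    (hCU : 0 ≤ CU) (hn : 1 ≤ n) (hδ : 0 ≤ δ) :
    ∃ A₁ A₂ c₁ ε₀ C₂ : ℝ, 0 < A₁ ∧ 0 < A₂ ∧ 0 < c₁ ∧ 0 < ε₀ ∧ ε₀ < 1 ∧ 0 < C₂ ∧
      ∀ ε H ξ z r y D S L : ℝ, 0 < ε → ε < ε₀ → 1 ≤ H → 0 ≤ ξ → 0 ≤ z → 0 ≤ y →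
        H ≤ n * a₁ + a₁ * y + C₈ * (1 + ξ + z) + S → S ≤ H * D + n → S ^ 2 ≤ n * (H ^ 2 * D + n) →
        ξ ^ 2 ≤ Cξ * H → z ^ 2 ≤ n ^ 2 * r → y ≤ CY * H →
        L ≤ 3 * A₁ * H ^ 2 * (-D + ε * δ * n) + n * (δ + 2) * (ξ * H) + 6 * A₁ * n * H + 2 * ξ
          + (H ^ 2 * D + H * ξ - a₂ * H * y + a₃ * n * H + C₅ * H * (1 + z + ξ))
          + A₂ * (4 * (S * z) + 2 * n ^ 2 * (1 + ξ) + CU * (1 + y) - 2 * a₄ * r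
            + C₇ * ((1 + z) * (1 + ξ))) →
        L ≤ -c₁ * H ^ 2 + C₂ := by
  obtain ⟨θ, hθ⟩ : ∃ θ, θ = a₂ / a₁ := ⟨_, rfl⟩
  have hθ0 : 0 < θ := by rw [hθ]; positivity
  have hθa : θ * a₁ = a₂ := by rw [hθ]; field_simp
  obtain ⟨C, hC⟩ : ∃ C, C = C₅ + θ * C₈ := ⟨_, rfl⟩
  obtain ⟨A₂, hA₂⟩ : ∃ A, A = C ^ 2 * n ^ 2 / (θ * a₄) + 1 := ⟨_, rfl⟩
  have hA₂0 : 0 < A₂ := by rw [hA₂]; positivity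
  obtain ⟨A₁, hA₁⟩ : ∃ A, A = (θ + 1 + 8 * A₂ * n ^ 3 / a₄) / 3 := ⟨_, rfl⟩
  have hA₁0 : 0 < A₁ := by rw [hA₁]; positivity
  obtain ⟨k₁, hk₁⟩ : ∃ k, k = n * (δ + 2) + 1 + C := ⟨_, rfl⟩
  obtain ⟨B, hB⟩ : ∃ B, B = C₇ ^ 2 * n ^ 2 / a₄ := ⟨_, rfl⟩
  have hB0 : 0 ≤ B := by rw [hB]; positivity
  have hC0 : 0 ≤ C := by rw [hC]; positivity
  obtain ⟨k₂, hk₂⟩ : ∃ k, k = 6 * A₁ * n + a₃ * n + C + θ * (n * a₁ + n)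
    + (2 + A₂ * (2 * n ^ 2 + C₇)) * Cξ + A₂ * CU * CY + A₂ * B * Cξ + 2 * k₁ ^ 2 / θ * Cξ := ⟨_, rfl⟩
  obtain ⟨k₃, hk₃⟩ : ∃ k, k = 2 + A₂ * (8 * n ^ 4 / a₄ + 4 * n ^ 2 + CU + 2 * C₇ + B) := ⟨_, rfl⟩
  have hk₃0 : 0 < k₃ := by rw [hk₃]; positivity
  refine ⟨A₁, A₂, θ / 4, min (1 / 2) (θ / (12 * A₁ * δ * n + 1)), 2 * k₂ ^ 2 / θ + k₃, hA₁0, hA₂0,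
    by positivity, by positivity, (min_le_left _ _).trans_lt (by norm_num), by positivity, ?_⟩
  intro ε H ξ z r y D S L hε hεlt hH hξ hz hy hHle hS hS2 hξ2 hz2 hyle hL
  have hH0 : 0 < H := by linarith
  have hε1 : 3 * A₁ * (ε * δ * n) ≤ θ / 4 := by
    have h := hεlt.trans_le (min_le_right _ _)
    rw [lt_div_iff₀ (by positivity)] at h
    linarith
  have s0 : 3 * A₁ * (ε * δ * n) * H ^ 2 ≤ θ / 4 * H ^ 2 := by gcongr
  have s1 : θ * H ^ 2 ≤ a₂ * H * y + θ * (n * a₁ * H + C₈ * H * (1 + ξ + z) + H ^ 2 * D + H * n) := by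
    have h := mul_le_mul_of_nonneg_left (hHle.trans (add_le_add_right hS _))
      (mul_pos hθ0 hH0).le
    rw [← hθa]
    linarith
  have s2 : C * (H * z) ≤ θ / 4 * H ^ 2 + A₂ * a₄ * r := by
    have h := mul_le_sq_add_sq (by positivity : 0 < θ / 4) C H z
    have h2 : C ^ 2 / (4 * (θ / 4)) * z ^ 2 ≤ C ^ 2 / (4 * (θ / 4)) * (n ^ 2 * r) := by gcongr
    have hr : 0 ≤ r := by
      by_contra hr
      push Not at hr
      linarith [sq_nonneg z, mul_neg_of_pos_of_neg (pow_pos (by linarith : 0 < n) 2) hr]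
    have h3 : C ^ 2 / (4 * (θ / 4)) * (n ^ 2 * r) = (A₂ - 1) * a₄ * r := by
      rw [hA₂]; field_simp; ring
    linarith [mul_nonneg ha₄.le hr]
  have s3 : 4 * (S * z) ≤ a₄ / 2 * r + 8 * n ^ 3 / a₄ * (H ^ 2 * D + n) := by
    have h := mul_le_sq_add_sq (by positivity : 0 < 8 * n ^ 2 / a₄) 4 S z
    have h2 : 8 * n ^ 2 / a₄ * S ^ 2 ≤ 8 * n ^ 2 / a₄ * (n * (H ^ 2 * D + n)) := by gcongr
    have h3 : 4 ^ 2 / (4 * (8 * n ^ 2 / a₄)) * z ^ 2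
      ≤ 4 ^ 2 / (4 * (8 * n ^ 2 / a₄)) * (n ^ 2 * r) := by gcongr
    have h4 : 4 ^ 2 / (4 * (8 * n ^ 2 / a₄)) * (n ^ 2 * r) = a₄ / 2 * r := by field_simp; ring
    have h5 : 8 * n ^ 2 / a₄ * (n * (H ^ 2 * D + n)) = 8 * n ^ 3 / a₄ * (H ^ 2 * D + n) := by
      field_simp
    linarith
  have s4 : ∀ x, C₇ * (z * x) ≤ a₄ / 4 * r + B * x ^ 2 := by
    intro x
    have h := mul_le_sq_add_sq (by positivity : 0 < a₄ / (4 * n ^ 2)) C₇ z x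
    have h2 : a₄ / (4 * n ^ 2) * z ^ 2 ≤ a₄ / (4 * n ^ 2) * (n ^ 2 * r) := by gcongr
    have h3 : a₄ / (4 * n ^ 2) * (n ^ 2 * r) = a₄ / 4 * r := by field_simp
    have h4 : C₇ ^ 2 / (4 * (a₄ / (4 * n ^ 2))) = B := by rw [hB]; field_simp
    rw [h4] at h
    linarith
  have s5 : ξ ≤ 1 + Cξ * H := by nlinarith [sq_nonneg (ξ - 1)]
  have s6 : k₁ * (ξ * H) ≤ θ / 8 * H ^ 2 + 2 * k₁ ^ 2 / θ * Cξ * H := by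
    have h := mul_le_sq_add_sq (by positivity : 0 < θ / 8) k₁ H ξ
    have h2 : k₁ ^ 2 / (4 * (θ / 8)) * ξ ^ 2 ≤ k₁ ^ 2 / (4 * (θ / 8)) * (Cξ * H) := by gcongr
    have h3 : k₁ ^ 2 / (4 * (θ / 8)) * (Cξ * H) = 2 * k₁ ^ 2 / θ * Cξ * H := by
      field_simp; ring
    linarith
  have s7 : k₂ * H ≤ θ / 8 * H ^ 2 + 2 * k₂ ^ 2 / θ := by
    have h := mul_le_sq_add_sq (by positivity : 0 < θ / 8) k₂ H 1
    have h3 : k₂ ^ 2 / (4 * (θ / 8)) * 1 ^ 2 = 2 * k₂ ^ 2 / θ := by field_simp; ring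
    linarith
  have t1 : A₂ * (4 * (S * z) + 2 * n ^ 2 * (1 + ξ) + CU * (1 + y) - 2 * a₄ * r
            + C₇ * ((1 + z) * (1 + ξ)))
      ≤ A₂ * (-a₄ * r + 8 * n ^ 3 / a₄ * (H ^ 2 * D + n) + 2 * n ^ 2 * (1 + (1 + Cξ * H))
        + CU * (1 + CY * H) + C₇ * (1 + (1 + Cξ * H)) + B + B * (Cξ * H)) := by
    refine mul_le_mul_of_nonneg_left ?_ hA₂0.le
    have h1 : 2 * n ^ 2 * (1 + ξ) ≤ 2 * n ^ 2 * (1 + (1 + Cξ * H)) := by gcongr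
    have h2 : CU * (1 + y) ≤ CU * (1 + CY * H) := by gcongr
    have h3 : C₇ * (1 + ξ) ≤ C₇ * (1 + (1 + Cξ * H)) := by gcongr
    have h4 : B * ξ ^ 2 ≤ B * (Cξ * H) := by gcongr
    have h5 := s4 1
    have h6 := s4 ξ
    linarith
  have t2 : A₂ * (8 * n ^ 3 / a₄ * (H ^ 2 * D + n)) = (3 * A₁ - θ - 1) * (H ^ 2 * D)
      + A₂ * (8 * n ^ 4 / a₄) := by
    rw [hA₁]; field_simp; ring
  have t3 : C₅ * H * (1 + z + ξ) + θ * (C₈ * H * (1 + ξ + z)) = C * H + C * (H * z) + C * (ξ * H) := by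
    rw [hC]; ring
  have t4 : k₁ * (ξ * H) = n * (δ + 2) * (ξ * H) + H * ξ + C * (ξ * H) := by rw [hk₁]; ring
  have t5 : k₂ * H = 6 * A₁ * n * H + a₃ * n * H + C * H + θ * (n * a₁ * H + H * n)
      + (2 + A₂ * (2 * n ^ 2 + C₇)) * (Cξ * H) + A₂ * CU * (CY * H) + A₂ * B * (Cξ * H)
      + 2 * k₁ ^ 2 / θ * Cξ * H := by rw [hk₂]; ring
  linarith

section Position

variable {d N : ℕ} {ε : ℝ} {U G : EuclideanSpace ℝ (Fin d) → ℝ}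

lemma pairSum_sq_le {f : Fin N → Fin N → ℝ} (hN : 0 < N) :
    pairSum f ^ 2 ≤ (N : ℝ) ^ 2 * pairSum (fun i j => f i j ^ 2) := by
  have hN' : (0 : ℝ) < N := by exact_mod_cast hN
  obtain ⟨t, ht⟩ : ∃ t, t = pairSum f / (N : ℝ) ^ 2 := ⟨_, rfl⟩
  have h1 : 2 * t * pairSum f - pairSum (fun _ _ : Fin N => t ^ 2)
      ≤ pairSum (fun i j => f i j ^ 2) := by
    rw [← pairSum_mul_left, ← pairSum_sub]
    exact pairSum_le_pairSum fun i j _ => by nlinarith [sq_nonneg (f i j - t)]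
  have h2 := pairSum_const_le (N := N) (sq_nonneg t)
  have h3 : pairSum f = (N : ℝ) ^ 2 * t := by rw [ht]; field_simp
  have h4 := mul_le_mul_of_nonneg_left (show (N : ℝ) ^ 2 * t ^ 2 ≤
    pairSum (fun i j => f i j ^ 2) by rw [h3] at h1; linarith) (sq_nonneg (N : ℝ))
  rw [h3]
  linarith

lemma norm_sub_le_sum {q : Fin N → EuclideanSpace ℝ (Fin d)} {i j : Fin N} (hij : i ≠ j) :
    ‖q i - q j‖ ≤ ∑ k, ‖q k‖ := by
  refine (norm_sub_le _ _).trans ?_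
  rw [← Finset.sum_pair (f := fun i => ‖q i‖) hij]
  exact Finset.sum_le_sum_of_subset_of_nonneg (Finset.subset_univ _) fun _ _ _ => norm_nonneg _

lemma sum_norm_sq_le {lam : ℝ} (hlam : 1 ≤ lam) (q : Fin N → EuclideanSpace ℝ (Fin d)) :
    (∑ i, ‖q i‖) ^ 2 ≤ N * (N + ∑ i, ‖q i‖ ^ (lam + 1)) := by
  have h := sq_sum_le_card_mul_sum_sq (s := (Finset.univ : Finset (Fin N))) (f := fun i => ‖q i‖)
  rw [Finset.card_univ, Fintype.card_fin] at h
  refine h.trans (mul_le_mul_of_nonneg_left ?_ (by positivity))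
  calc ∑ i, ‖q i‖ ^ 2 ≤ ∑ i, (1 + ‖q i‖ ^ (lam + 1)) := Finset.sum_le_sum fun i _ => by
        rcases le_total ‖q i‖ 1 with h1 | h1
        · have : 0 ≤ ‖q i‖ ^ (lam + 1) := by positivity
          nlinarith [norm_nonneg (q i)]
        · have := Real.rpow_le_rpow_of_exponent_le h1 (by linarith : (2 : ℝ) ≤ lam + 1)
          rw [Real.rpow_two] at this
          linarith
    _ = _ := by simp [Finset.sum_add_distrib]

lemma one_add_rpow_le {t s : ℝ} (ht : 0 ≤ t) (hs : 0 ≤ s) :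
    (1 + t) ^ s ≤ 2 ^ s * (1 + t ^ s) := by
  have h2 : (0 : ℝ) < 2 ^ s := by positivity
  have ht' : 0 ≤ t ^ s := by positivity
  rcases le_total t 1 with h1 | h1
  · have : (1 + t) ^ s ≤ 2 ^ s := Real.rpow_le_rpow (by linarith) (by linarith) hs
    nlinarith
  · have : (1 + t) ^ s ≤ (2 * t) ^ s := Real.rpow_le_rpow (by linarith) (by linarith) hs
    rw [Real.mul_rpow (by norm_num) ht] at this
    linarith

lemma exists_one_add_sum_mul_le {lam : ℝ} (hlam : 1 ≤ lam) (hN : 0 < N) :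
    ∃ C : ℝ, 0 ≤ C ∧ ∀ q : Fin N → EuclideanSpace ℝ (Fin d),
      (1 + ∑ i, ‖q i‖) * ∑ i, (1 + ‖q i‖ ^ lam) ≤ C * (1 + ∑ i, ‖q i‖ ^ (lam + 1)) := by
  have hN1 : (1 : ℝ) ≤ N := by exact_mod_cast hN
  refine ⟨2 * N * (N ^ lam * (2 ^ (lam + 1) * N)), by positivity, fun q => ?_⟩
  have hX : 0 ≤ ∑ i, ‖q i‖ := by positivity
  have hY : 0 ≤ ∑ i, ‖q i‖ ^ (lam + 1) := by positivity
  have h1 : ∑ i, (1 + ‖q i‖ ^ lam) ≤ 2 * N * (1 + ∑ i, ‖q i‖) ^ lam := by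
    calc ∑ i, (1 + ‖q i‖ ^ lam) ≤ ∑ _i : Fin N, 2 * (1 + ∑ i, ‖q i‖) ^ lam :=
          Finset.sum_le_sum fun i _ => by
            have h2 : ‖q i‖ ≤ ∑ i, ‖q i‖ :=
              Finset.single_le_sum (f := fun i => ‖q i‖) (fun _ _ => norm_nonneg _)
                (Finset.mem_univ i)
            have h3 : ‖q i‖ ^ lam ≤ (1 + ∑ i, ‖q i‖) ^ lam :=
              Real.rpow_le_rpow (norm_nonneg _) (by linarith) (by linarith)
            have h4 : 1 ≤ (1 + ∑ i, ‖q i‖) ^ lam := Real.one_le_rpow (by linarith) (by linarith)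
            linarith
      _ = _ := by simp; ring
  have h2 : (1 + ∑ i, ‖q i‖) ^ (lam + 1) ≤ N ^ lam * (2 ^ (lam + 1) * (N + ∑ i, ‖q i‖ ^ (lam + 1))) := by
    calc (1 + ∑ i, ‖q i‖) ^ (lam + 1) ≤ (∑ i, (1 + ‖q i‖)) ^ (lam + 1) := by
          refine Real.rpow_le_rpow (by linarith) ?_ (by linarith)
          simp [Finset.sum_add_distrib, hN1]
      _ ≤ N ^ lam * ∑ i, (1 + ‖q i‖) ^ (lam + 1) := by
          have := Real.rpow_sum_le_const_mul_sum_rpow_of_nonneg (s := (Finset.univ : Finset (Fin N)))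
            (f := fun i => 1 + ‖q i‖) (p := lam + 1) (by linarith) (fun _ _ => by positivity)
          simpa using this
      _ ≤ N ^ lam * ∑ i, 2 ^ (lam + 1) * (1 + ‖q i‖ ^ (lam + 1)) := by
          gcongr
          exact one_add_rpow_le (norm_nonneg _) (by linarith)
      _ = _ := by rw [← Finset.mul_sum]; simp [Finset.sum_add_distrib]
  calc (1 + ∑ i, ‖q i‖) * ∑ i, (1 + ‖q i‖ ^ lam)
      ≤ (1 + ∑ i, ‖q i‖) * (2 * N * (1 + ∑ i, ‖q i‖) ^ lam) := by gcongr
    _ = 2 * N * (1 + ∑ i, ‖q i‖) ^ (lam + 1) := by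
        rw [Real.rpow_add (by linarith), Real.rpow_one]; ring
    _ ≤ 2 * N * (N ^ lam * (2 ^ (lam + 1) * (N + ∑ i, ‖q i‖ ^ (lam + 1)))) := by gcongr
    _ ≤ 2 * N * (N ^ lam * (2 ^ (lam + 1) * (N * (1 + ∑ i, ‖q i‖ ^ (lam + 1))))) := by
        gcongr; nlinarith
    _ = _ := by ring

lemma exists_mul_sum_rpow_le_HN {a lam C : ℝ} (ha : 0 < a) (hlam : 1 ≤ lam) (hC : 0 ≤ C)
    (hN : 0 < N)
    (hU : ∀ x : EuclideanSpace ℝ (Fin d), 1 / a * ‖x‖ ^ (lam + 1) - a ≤ U x)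
    (hG : ∀ x, x ≠ 0 → -(C * (1 + ‖x‖)) ≤ G x) :
    ∃ K : ℝ, 0 ≤ K ∧ ∀ ε, 0 < ε → ε ≤ 1 → ∀ q p : Fin N → EuclideanSpace ℝ (Fin d),
      Function.Injective q → 1 ≤ HN ε U G q p →
      ε * ∑ i, ‖q i‖ ^ (lam + 1) ≤ K * HN ε U G q p := by
  have hN0 : (0 : ℝ) < N := by exact_mod_cast hN
  obtain ⟨k, hk⟩ : ∃ k, k = (N : ℝ) ^ 2 * C := ⟨_, rfl⟩
  obtain ⟨B, hB⟩ : ∃ B, B = N * a + k + k ^ 2 / (4 * (1 / (2 * a * N))) + N / (2 * a) := ⟨_, rfl⟩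
  have hB0 : 0 ≤ B := by rw [hB, hk]; positivity
  refine ⟨2 * a * (1 + B), by positivity, fun ε hε hε1 q p hq hH => ?_⟩
  have h1 : 1 / a * ∑ i, ‖q i‖ ^ (lam + 1) - N * a ≤ ∑ i, U (q i) := by
    calc 1 / a * ∑ i, ‖q i‖ ^ (lam + 1) - N * a = ∑ i, (1 / a * ‖q i‖ ^ (lam + 1) - a) := by
          simp [Finset.mul_sum]
      _ ≤ _ := Finset.sum_le_sum fun i _ => hU _
  have h2 : -(k * (1 + ∑ i, ‖q i‖)) ≤ pairSum (fun i j => G (q i - q j)) := by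
    have h3 : pairSum (fun _ _ : Fin N => C * (1 + ∑ i, ‖q i‖)) ≤ k * (1 + ∑ i, ‖q i‖) := by
      rw [hk, mul_assoc]; exact pairSum_const_le (by positivity)
    refine (neg_le_neg h3).trans ?_
    rw [← pairSum_neg]
    refine pairSum_le_pairSum fun i j hij => ?_
    refine le_trans ?_ (hG _ (sub_ne_zero.2 (hq.ne hij.ne)))
    have := norm_sub_le_sum (q := q) hij.ne
    gcongr
  have h3 := mul_le_sq_add_sq (by positivity : 0 < 1 / (2 * a * (N : ℝ))) k (∑ i, ‖q i‖) 1
  have h4 : 1 / (2 * a * (N : ℝ)) * (∑ i, ‖q i‖) ^ 2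
      ≤ N / (2 * a) + 1 / (2 * a) * ∑ i, ‖q i‖ ^ (lam + 1) := by
    have := mul_le_mul_of_nonneg_left (sum_norm_sq_le hlam q)
      (by positivity : 0 ≤ 1 / (2 * a * (N : ℝ)))
    refine this.trans (le_of_eq ?_)
    field_simp
  have h5 : 1 / a * ∑ i, ‖q i‖ ^ (lam + 1) = 2 * (1 / (2 * a) * ∑ i, ‖q i‖ ^ (lam + 1)) := by
    field_simp
  have h6 : 1 / (2 * a) * ∑ i, ‖q i‖ ^ (lam + 1) - B
      ≤ ∑ i, U (q i) + pairSum (fun i j => G (q i - q j)) := by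
    rw [hB]; linarith
  have h7 : ε * (∑ i, U (q i) + pairSum (fun i j => G (q i - q j))) ≤ HN ε U G q p := by
    have : 0 ≤ ∑ i, Real.sqrt (1 + ε * ‖p i‖ ^ 2) := by positivity
    unfold HN
    change ε * (∑ i, U (q i) + pairSum (fun i j => G (q i - q j)))
      ≤ ε * ∑ i, U (q i) + ε * pairSum (fun i j => G (q i - q j)) + _
    linarith
  have h8 := mul_le_mul_of_nonneg_left h6 hε.le
  have h9 : ε * B ≤ B * HN ε U G q p := by nlinarith
  have h10 : ε * ∑ i, ‖q i‖ ^ (lam + 1)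
      = 2 * a * (ε * (1 / (2 * a) * ∑ i, ‖q i‖ ^ (lam + 1))) := by field_simp
  rw [h10, mul_assoc (2 * a)]
  refine mul_le_mul_of_nonneg_left ?_ (by positivity)
  linarith

lemma HN_le {a lam C γ : ℝ} (ha : 0 ≤ a) (hC : 0 ≤ C) (hN : 0 < N) (hε : 0 < ε) (hε1 : ε ≤ 1)
    (hU : ∀ x : EuclideanSpace ℝ (Fin d), U x ≤ a * (1 + ‖x‖ ^ (lam + 1)))
    (hG : ∀ x, x ≠ 0 → G x ≤ C * (1 + ‖x‖ + ‖x‖ ^ (-γ)))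
    {q p : Fin N → EuclideanSpace ℝ (Fin d)} (hq : Function.Injective q) :
    HN ε U G q p ≤ N * a + a * (ε * ∑ i, ‖q i‖ ^ (lam + 1))
      + C * (N : ℝ) ^ 2 * (1 + Real.sqrt ε * ∑ i, ‖q i‖
        + ε * pairSum (fun i j => ‖q i - q j‖ ^ (-γ)))
      + ∑ i, Real.sqrt (1 + ε * ‖p i‖ ^ 2) := by
  have hN1 : (1 : ℝ) ≤ N := by exact_mod_cast hN
  have hX : 0 ≤ ∑ i, ‖q i‖ := by positivity
  have hP : 0 ≤ pairSum (fun i j => ‖q i - q j‖ ^ (-γ)) := pairSum_nonneg fun i j _ => by positivity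
  have h1 : ∑ i, U (q i) ≤ N * a + a * ∑ i, ‖q i‖ ^ (lam + 1) := by
    calc ∑ i, U (q i) ≤ ∑ i, (a + a * ‖q i‖ ^ (lam + 1)) :=
          Finset.sum_le_sum fun i _ => (hU _).trans (by linarith)
      _ = _ := by simp [Finset.sum_add_distrib, Finset.mul_sum]
  have h2 : pairSum (fun i j => G (q i - q j))
      ≤ C * ((N : ℝ) ^ 2 * (1 + ∑ i, ‖q i‖) + pairSum (fun i j => ‖q i - q j‖ ^ (-γ))) := by
    calc pairSum (fun i j => G (q i - q j))
        ≤ pairSum (fun i j => C * ((1 + ∑ i, ‖q i‖) + ‖q i - q j‖ ^ (-γ))) :=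
          pairSum_le_pairSum fun i j hij => by
            refine (hG _ (sub_ne_zero.2 (hq.ne hij.ne))).trans ?_
            have := norm_sub_le_sum (q := q) hij.ne
            gcongr
      _ = C * (pairSum (fun _ _ : Fin N => 1 + ∑ i, ‖q i‖)
            + pairSum (fun i j => ‖q i - q j‖ ^ (-γ))) := by
          rw [pairSum_mul_left, ← pairSum_add]
      _ ≤ _ := by gcongr; exact pairSum_const_le (by positivity)
  have h3 : ε ≤ Real.sqrt ε := Real.le_sqrt_of_sq_le (by nlinarith)
  have h4 : ε * ((N : ℝ) ^ 2 * (1 + ∑ i, ‖q i‖) + pairSum (fun i j => ‖q i - q j‖ ^ (-γ)))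
      ≤ (N : ℝ) ^ 2 * (1 + Real.sqrt ε * ∑ i, ‖q i‖
        + ε * pairSum (fun i j => ‖q i - q j‖ ^ (-γ))) := by
    have h5 := mul_le_mul_of_nonneg_right h3 hX
    have h6 : 0 ≤ ε * pairSum (fun i j => ‖q i - q j‖ ^ (-γ)) := by positivity
    have h7 : (1 : ℝ) ≤ (N : ℝ) ^ 2 := by nlinarith
    nlinarith [mul_le_mul_of_nonneg_right h7 h6]
  have h5 := mul_le_mul_of_nonneg_left h1 hε.le
  have h6 := mul_le_mul_of_nonneg_left h2 hε.le
  have h7 := mul_le_mul_of_nonneg_left h4 hC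
  have h8 : ε * (N * a) ≤ N * a := by
    have : 0 ≤ N * a := by positivity
    nlinarith
  unfold HN
  change ε * ∑ i, U (q i) + ε * pairSum (fun i j => G (q i - q j)) + _ ≤ _
  linarith

end Position

section Drift

variable {d N : ℕ} {ε : ℝ} {U G : EuclideanSpace ℝ (Fin d) → ℝ}

lemma mul_sum_inner_momentumDrift_le {a₂ a₃ a₄ C γ lam : ℝ} (hε : 0 < ε) (hε1 : ε ≤ 1)
    (ha₃ : 0 ≤ a₃) (ha₄ : 0 ≤ a₄) (hC : 0 ≤ C) (hN : 0 < N) (hγ0 : 0 ≤ γ) (hγ1 : γ ≤ 1)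
    (hGodd : ∀ x, x ≠ 0 → gradient G (-x) = -gradient G x)
    (hU : ∀ x : EuclideanSpace ℝ (Fin d), a₂ * ‖x‖ ^ (lam + 1) - a₃ ≤ ⟪gradient U x, x⟫)
    (hG : ∀ x : EuclideanSpace ℝ (Fin d), x ≠ 0 →
      ‖gradient G x + a₄ • pairForce (γ + 2) x‖ ≤ C * (1 + ‖x‖ ^ (-γ)))
    {q : Fin N → EuclideanSpace ℝ (Fin d)} (hq : Function.Injective q)
    (p : Fin N → EuclideanSpace ℝ (Fin d)) :
    ε * ∑ i, ⟪q i, momentumDrift ε U G q p i⟫ ≤ Real.sqrt ε * ∑ i, ‖q i‖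
      - a₂ * (ε * ∑ i, ‖q i‖ ^ (lam + 1)) + a₃ * N
      + (a₄ + 2 * C) * (N : ℝ) ^ 2 * (1 + ε * pairSum (fun i j => ‖q i - q j‖ ^ (-γ))
        + Real.sqrt ε * ∑ i, ‖q i‖) := by
  have hN1 : (1 : ℝ) ≤ N := by exact_mod_cast hN
  have hX : 0 ≤ ∑ i, ‖q i‖ := by positivity
  have hP : 0 ≤ pairSum (fun i j => ‖q i - q j‖ ^ (-γ)) := pairSum_nonneg fun i j _ => by positivity
  have h1 : -(ε * ∑ i, ⟪q i, velocity ε p i⟫) ≤ Real.sqrt ε * ∑ i, ‖q i‖ := by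
    have h2 := mul_le_mul_of_nonneg_left (sqrt_mul_abs_sum_inner_velocity_le hε q p)
      (Real.sqrt_nonneg ε)
    rw [← mul_assoc, Real.mul_self_sqrt hε.le] at h2
    have h3 := mul_le_mul_of_nonneg_left (neg_abs_le (∑ i, ⟪q i, velocity ε p i⟫)) hε.le
    linarith
  have h2 : a₂ * ∑ i, ‖q i‖ ^ (lam + 1) - N * a₃ ≤ ∑ i, ⟪gradient U (q i), q i⟫ := by
    calc a₂ * ∑ i, ‖q i‖ ^ (lam + 1) - N * a₃ = ∑ i, (a₂ * ‖q i‖ ^ (lam + 1) - a₃) := by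
          simp [Finset.mul_sum]
      _ ≤ _ := Finset.sum_le_sum fun i _ => hU _
  have h3 : ∀ x : EuclideanSpace ℝ (Fin d), x ≠ 0 →
      -⟪gradient G x, x⟫ ≤ (a₄ + 2 * C) * (1 + ‖x‖ + ‖x‖ ^ (-γ)) := by
    intro x hx
    have hx0 : 0 < ‖x‖ := norm_pos_iff.2 hx
    have hp := Real.rpow_pos_of_pos hx0 (-γ)
    have e1 : ⟪pairForce (γ + 2) x, x⟫ = ‖x‖ ^ (-γ) := by
      rw [pairForce, inner_smul_left, real_inner_self_eq_norm_sq, conj_trivial,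
        Real.rpow_add hx0, Real.rpow_two, Real.rpow_neg hx0.le]
      field_simp
    have e2 : ⟪gradient G x + a₄ • pairForce (γ + 2) x, x⟫
        = ⟪gradient G x, x⟫ + a₄ * ‖x‖ ^ (-γ) := by
      rw [inner_add_left, inner_smul_left, e1, conj_trivial]
    have h4 := (abs_le.1 (abs_real_inner_le_norm (gradient G x + a₄ • pairForce (γ + 2) x) x)).1
    rw [e2] at h4
    have h5 := mul_le_mul_of_nonneg_right (hG x hx) hx0.le
    have h6 : ‖x‖ ^ (-γ) * ‖x‖ ≤ 1 + ‖x‖ := by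
      rcases le_total ‖x‖ 1 with h | h
      · have : ‖x‖ ^ (-γ) * ‖x‖ = ‖x‖ ^ (1 - γ) := by
          rw [show 1 - γ = -γ + 1 by ring, Real.rpow_add hx0, Real.rpow_one]
        rw [this]
        linarith [Real.rpow_le_one hx0.le h (by linarith : 0 ≤ 1 - γ)]
      · have := Real.rpow_le_one_of_one_le_of_nonpos h (by linarith : -γ ≤ 0)
        nlinarith
    have h7 := mul_le_mul_of_nonneg_left h6 hC
    have h8 : 0 ≤ a₄ * (1 + ‖x‖) := by positivity
    have h9 : 0 ≤ C * (1 + 2 * ‖x‖ ^ (-γ)) := by positivity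
    linarith
  have h4 : -pairSum (fun i j => ⟪gradient G (q i - q j), q i - q j⟫)
      ≤ (a₄ + 2 * C) * ((N : ℝ) ^ 2 * (1 + ∑ i, ‖q i‖)
        + pairSum (fun i j => ‖q i - q j‖ ^ (-γ))) := by
    rw [← pairSum_neg]
    calc pairSum (fun i j => -⟪gradient G (q i - q j), q i - q j⟫)
        ≤ pairSum (fun i j => (a₄ + 2 * C) * ((1 + ∑ i, ‖q i‖) + ‖q i - q j‖ ^ (-γ))) :=
          pairSum_le_pairSum fun i j hij => by
            refine (h3 _ (sub_ne_zero.2 (hq.ne hij.ne))).trans ?_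
            have := norm_sub_le_sum (q := q) hij.ne
            gcongr
      _ = (a₄ + 2 * C) * (pairSum (fun _ _ : Fin N => 1 + ∑ i, ‖q i‖)
            + pairSum (fun i j => ‖q i - q j‖ ^ (-γ))) := by
          rw [pairSum_mul_left, ← pairSum_add]
      _ ≤ _ := by gcongr; exact pairSum_const_le (by positivity)
  have h5 : ε ≤ Real.sqrt ε := Real.le_sqrt_of_sq_le (by nlinarith)
  have h6 : ε * ((N : ℝ) ^ 2 * (1 + ∑ i, ‖q i‖) + pairSum (fun i j => ‖q i - q j‖ ^ (-γ)))
      ≤ (N : ℝ) ^ 2 * (1 + ε * pairSum (fun i j => ‖q i - q j‖ ^ (-γ))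
        + Real.sqrt ε * ∑ i, ‖q i‖) := by
    have h5 := mul_le_mul_of_nonneg_right h5 hX
    have h6 : 0 ≤ ε * pairSum (fun i j => ‖q i - q j‖ ^ (-γ)) := by positivity
    have h7 : (1 : ℝ) ≤ (N : ℝ) ^ 2 := by nlinarith
    nlinarith [mul_le_mul_of_nonneg_right h7 h6]
  have h7 := mul_le_mul_of_nonneg_left h6 (by positivity : 0 ≤ a₄ + 2 * C)
  have h8 := mul_le_mul_of_nonneg_left h4 hε.le
  have h9 := mul_le_mul_of_nonneg_left h2 hε.le
  have h10 : ε * (N * a₃) ≤ a₃ * N := by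
    have : 0 ≤ N * a₃ := by positivity
    nlinarith
  rw [inner_momentumDrift_sum hGodd hq]
  linarith

lemma abs_pairVirial_le {γ : ℝ} (hγ0 : 0 ≤ γ) (hγ1 : γ ≤ 1)
    {q : Fin N → EuclideanSpace ℝ (Fin d)} (hq : Function.Injective q)
    (w : Fin N → EuclideanSpace ℝ (Fin d)) :
    |pairVirial γ q w| ≤ N * ((1 + ∑ i, ‖q i‖) * ∑ i, ‖w i‖) := by
  have hX : 0 ≤ ∑ i, ‖q i‖ := by positivity
  have h1 : |pairVirial γ q w| ≤ pairSum (fun i j => (1 + ∑ i, ‖q i‖) * (‖w i‖ + ‖w j‖)) := by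
    refine abs_pairSum_le fun i j hij => ?_
    have hx : q i - q j ≠ 0 := sub_ne_zero.2 (hq.ne hij.ne)
    have hx0 : 0 < ‖q i - q j‖ := norm_pos_iff.2 hx
    have h2 : ‖pairForce γ (q i - q j)‖ ≤ 1 + ∑ i, ‖q i‖ := by
      have e : ‖pairForce γ (q i - q j)‖ = ‖q i - q j‖ ^ (1 - γ) := by
        rw [pairForce, norm_smul, norm_inv, Real.norm_of_nonneg (by positivity),
          Real.rpow_sub hx0, Real.rpow_one]
        field_simp
      rw [e]
      have h3 := norm_sub_le_sum (q := q) hij.ne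
      rcases le_total ‖q i - q j‖ 1 with h | h
      · linarith [Real.rpow_le_one hx0.le h (by linarith : 0 ≤ 1 - γ)]
      · have := Real.rpow_le_rpow_of_exponent_le h (by linarith : 1 - γ ≤ 1)
        rw [Real.rpow_one] at this
        linarith
    refine (abs_real_inner_le_norm _ _).trans ?_
    rw [mul_comm]
    exact mul_le_mul h2 (norm_sub_le _ _) (norm_nonneg _) (by linarith)
  rw [pairSum_mul_left, ← sum_sum_ne_eq_pairSum (fun i _ => ‖w i‖)] at h1
  have h2 : ∑ i : Fin N, ∑ _j ∈ Finset.univ.filter (fun j => j ≠ i), ‖w i‖ ≤ N * ∑ i, ‖w i‖ := by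
    rw [Finset.mul_sum]
    refine Finset.sum_le_sum fun i _ => ?_
    calc ∑ _j ∈ Finset.univ.filter (fun j => j ≠ i), ‖w i‖ ≤ ∑ _j : Fin N, ‖w i‖ :=
          Finset.sum_le_sum_of_subset_of_nonneg (Finset.filter_subset _ _)
            fun _ _ _ => norm_nonneg _
      _ = _ := by simp
  have h3 := mul_le_mul_of_nonneg_left h2 (by positivity : 0 ≤ 1 + ∑ i, ‖q i‖)
  linarith

set_option maxHeartbeats 1000000 in
/-- The singular repulsion makes the virial of the drift large and positive. -/
lemma neg_mul_pairVirial_momentumDrift_le {a₁ a₄ C γ lam K : ℝ} (hε : 0 < ε) (hε1 : ε ≤ 1)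
    (ha₁ : 0 ≤ a₁) (ha₄ : 0 ≤ a₄) (hC : 0 ≤ C) (hK : 0 ≤ K) (hN : 0 < N)
    (hγ0 : 0 ≤ γ) (hγ1 : γ ≤ 1)
    (hU : ∀ x : EuclideanSpace ℝ (Fin d), ‖gradient U x‖ ≤ a₁ * (1 + ‖x‖ ^ lam))
    (hG : ∀ x : EuclideanSpace ℝ (Fin d), x ≠ 0 →
      ‖gradient G x + a₄ • pairForce (γ + 2) x‖ ≤ C * (1 + ‖x‖ ^ (-γ)))
    {q : Fin N → EuclideanSpace ℝ (Fin d)} (hq : Function.Injective q)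
    (hKq : (1 + ∑ i, ‖q i‖) * ∑ i, (1 + ‖q i‖ ^ lam) ≤ K * (1 + ∑ i, ‖q i‖ ^ (lam + 1)))
    (p : Fin N → EuclideanSpace ℝ (Fin d)) :
    -(ε ^ 2 * pairVirial γ q (momentumDrift ε U G q p))
      ≤ 2 * (N : ℝ) ^ 2 * (1 + Real.sqrt ε * ∑ i, ‖q i‖)
        + N * a₁ * K * (1 + ε * ∑ i, ‖q i‖ ^ (lam + 1))
        - 2 * a₄ * (ε ^ 2 * pairSum (fun i j => (‖q i - q j‖ ^ (-γ)) ^ 2))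
        + 2 * C * (N : ℝ) ^ 3 * ((1 + ε * pairSum (fun i j => ‖q i - q j‖ ^ (-γ)))
          * (1 + Real.sqrt ε * ∑ i, ‖q i‖)) := by
  have hN1 : (1 : ℝ) ≤ N := by exact_mod_cast hN
  obtain ⟨F, hF⟩ : ∃ F : Fin N → EuclideanSpace ℝ (Fin d), F = fun i =>
    ∑ k ∈ Finset.univ.filter (fun k => k ≠ i), pairForce (γ + 2) (q i - q k) := ⟨_, rfl⟩
  obtain ⟨E, hE⟩ : ∃ E : Fin N → EuclideanSpace ℝ (Fin d), E = fun i =>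
    ∑ k ∈ Finset.univ.filter (fun k => k ≠ i),
      (gradient G (q i - q k) + a₄ • pairForce (γ + 2) (q i - q k)) := ⟨_, rfl⟩
  obtain ⟨w, hw⟩ : ∃ w : Fin N → EuclideanSpace ℝ (Fin d), w = fun i =>
    velocity ε p i + gradient U (q i) + E i := ⟨_, rfl⟩
  have hb : momentumDrift ε U G q p = -w + a₄ • F := by
    funext i
    change -velocity ε p i - gradient U (q i) - _ = -w i + a₄ • F i
    simp only [hw, hE, hF, Finset.sum_add_distrib, Finset.smul_sum]
    abel
  have hvir : pairVirial γ q (momentumDrift ε U G q p) = -pairVirial γ q w + a₄ * pairVirial γ q F := by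
    rw [hb, pairVirial_line]
    congr 1
    unfold pairVirial
    rw [← pairSum_neg]
    refine pairSum_congr fun i j _ => ?_
    change ⟪-w i - -w j, _⟫ = _
    rw [← inner_neg_left]
    congr 1
    abel
  have hFle : 2 * pairSum (fun i j => (‖q i - q j‖ ^ (-γ)) ^ 2) ≤ pairVirial γ q F := by
    rw [hF]; exact two_mul_pairSum_le_pairVirial hγ1 hq
  set X := ∑ i, ‖q i‖ with hX
  set Y := ∑ i, ‖q i‖ ^ (lam + 1) with hY
  set P := pairSum (fun i j => ‖q i - q j‖ ^ (-γ)) with hP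
  set R := pairSum (fun i j => (‖q i - q j‖ ^ (-γ)) ^ 2) with hR
  have hX0 : 0 ≤ X := by positivity
  have hY0 : 0 ≤ Y := by positivity
  have hP0 : 0 ≤ P := pairSum_nonneg fun i j _ => by positivity
  have hwle : Real.sqrt ε * ∑ i, ‖w i‖ ≤ N + Real.sqrt ε * (a₁ * ∑ i, (1 + ‖q i‖ ^ lam))
      + Real.sqrt ε * (2 * C * (N : ℝ) ^ 2 * (1 + P)) := by
    have h1 : ∑ i, ‖w i‖ ≤ ∑ i, ‖velocity ε p i‖ + ∑ i, ‖gradient U (q i)‖ + ∑ i, ‖E i‖ := by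
      rw [← Finset.sum_add_distrib, ← Finset.sum_add_distrib]
      exact Finset.sum_le_sum fun i _ => by rw [hw]; exact norm_add₃_le
    have h2 : Real.sqrt ε * ∑ i, ‖velocity ε p i‖ ≤ N := by
      rw [Finset.mul_sum]
      calc ∑ i, Real.sqrt ε * ‖velocity ε p i‖ ≤ ∑ _i : Fin N, (1 : ℝ) :=
            Finset.sum_le_sum fun i _ => sqrt_mul_norm_velocity_le hε p i
        _ = N := by simp
    have h3 : ∑ i, ‖gradient U (q i)‖ ≤ a₁ * ∑ i, (1 + ‖q i‖ ^ lam) := by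
      rw [Finset.mul_sum]
      exact Finset.sum_le_sum fun i _ => hU _
    have h4 : ∑ i, ‖E i‖ ≤ 2 * C * (N : ℝ) ^ 2 * (1 + P) := by
      calc ∑ i, ‖E i‖ ≤ ∑ i, ∑ k ∈ Finset.univ.filter (fun k => k ≠ i),
              C * (1 + ‖q i - q k‖ ^ (-γ)) := by
            refine Finset.sum_le_sum fun i _ => ?_
            rw [hE]
            refine norm_sum_le_of_le _ fun k hk => hG _ (sub_ne_zero.2 (hq.ne ?_))
            simpa using (Finset.mem_filter.1 hk).2.symm
        _ = 2 * C * (pairSum (fun _ _ : Fin N => (1 : ℝ)) + P) := by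
            rw [sum_sum_ne_eq_pairSum, hP, ← pairSum_add, ← pairSum_mul_left]
            refine pairSum_congr fun i j _ => ?_
            rw [norm_sub_rev (q j)]; ring
        _ ≤ 2 * C * ((N : ℝ) ^ 2 * 1 + P) := by gcongr; exact pairSum_const_le zero_le_one
        _ ≤ 2 * C * ((N : ℝ) ^ 2 * (1 + P)) := by
            gcongr
            have : (1 : ℝ) ≤ (N : ℝ) ^ 2 := by nlinarith
            nlinarith
        _ = _ := by ring
    have hs := Real.sqrt_nonneg ε
    have h5 := mul_le_mul_of_nonneg_left (h1.trans (add_le_add (add_le_add le_rfl h3) h4)) hs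
    linarith
  have hvw := (le_abs_self _).trans (abs_pairVirial_le hγ0 hγ1 hq w)
  rw [← hX] at hvw
  obtain ⟨s, hs⟩ : ∃ s, s = Real.sqrt ε := ⟨_, rfl⟩
  have hs0 : 0 < s := by rw [hs]; positivity
  have hs1 : s ≤ 1 := by rw [hs]; exact Real.sqrt_le_one.2 hε1
  have hsε : ε = s * s := by rw [hs, Real.mul_self_sqrt hε.le]
  rw [← hs] at hwle ⊢
  have h1 : ε ^ 2 * pairVirial γ q w ≤ s ^ 3 * (N * ((1 + X) * (N + s * (a₁ * ∑ i, (1 + ‖q i‖ ^ lam))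
      + s * (2 * C * (N : ℝ) ^ 2 * (1 + P))))) := by
    calc ε ^ 2 * pairVirial γ q w ≤ ε ^ 2 * (N * ((1 + X) * ∑ i, ‖w i‖)) := by gcongr
      _ = s ^ 3 * (N * ((1 + X) * (s * ∑ i, ‖w i‖))) := by rw [hsε]; ring
      _ ≤ _ := by gcongr
  have hsX : s * (1 + X) ≤ 1 + s * X := by linarith
  have hεX : ε * (1 + X) ≤ 1 + s * X := by
    rw [hsε, mul_assoc]
    have : 0 ≤ s * (1 + X) := by positivity
    nlinarith
  have h2 : s ^ 3 * (N * ((1 + X) * N)) ≤ 2 * (N : ℝ) ^ 2 * (1 + s * X) := by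
    have h3 : s * (ε * (1 + X)) ≤ 1 + s * X := by
      have : 0 ≤ ε * (1 + X) := by positivity
      nlinarith
    calc s ^ 3 * (N * ((1 + X) * N)) = (N : ℝ) ^ 2 * (s * (ε * (1 + X))) := by rw [hsε]; ring
      _ ≤ (N : ℝ) ^ 2 * (1 + s * X) := by gcongr
      _ ≤ _ := by
        have : 0 ≤ (N : ℝ) ^ 2 * (1 + s * X) := by positivity
        linarith
  have h3 : s ^ 3 * (N * ((1 + X) * (s * (a₁ * ∑ i, (1 + ‖q i‖ ^ lam)))))
      ≤ N * a₁ * K * (1 + ε * Y) := by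
    calc s ^ 3 * (N * ((1 + X) * (s * (a₁ * ∑ i, (1 + ‖q i‖ ^ lam)))))
        = N * a₁ * (ε ^ 2 * ((1 + X) * ∑ i, (1 + ‖q i‖ ^ lam))) := by rw [hsε]; ring
      _ ≤ N * a₁ * (ε ^ 2 * (K * (1 + Y))) := by gcongr
      _ = N * a₁ * K * (ε ^ 2 * (1 + Y)) := by ring
      _ ≤ N * a₁ * K * (1 + ε * Y) := by
        gcongr
        nlinarith [mul_nonneg hε.le hY0]
  have h4 : s ^ 3 * (N * ((1 + X) * (s * (2 * C * (N : ℝ) ^ 2 * (1 + P)))))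
      ≤ 2 * C * (N : ℝ) ^ 3 * ((1 + ε * P) * (1 + s * X)) := by
    calc s ^ 3 * (N * ((1 + X) * (s * (2 * C * (N : ℝ) ^ 2 * (1 + P)))))
        = 2 * C * (N : ℝ) ^ 3 * ((ε * (1 + P)) * (ε * (1 + X))) := by rw [hsε]; ring
      _ ≤ _ := by
        have : ε * (1 + P) ≤ 1 + ε * P := by linarith
        gcongr
  have h5 := mul_le_mul_of_nonneg_left hFle (by positivity : 0 ≤ ε ^ 2 * a₄)
  rw [hvir]
  linarith

end Drift

set_option maxHeartbeats 1000000 in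
/-- The generator applied to the Lyapunov candidate, bounded termwise by the Hamiltonian and the
scaled size of the configuration. -/
lemma LN_lyapunov_le {d N : ℕ} {ε : ℝ} {U G : EuclideanSpace ℝ (Fin d) → ℝ}
    {A₁ A₂ a₁ a₂ a₃ a₄ C γ lam K : ℝ} (hε : 0 < ε) (hε1 : ε ≤ 1) (hA₁ : 0 ≤ A₁) (hA₂ : 0 ≤ A₂)
    (ha₁ : 0 ≤ a₁) (ha₃ : 0 ≤ a₃) (ha₄ : 0 ≤ a₄) (hC : 0 ≤ C) (hK : 0 ≤ K) (hN : 0 < N)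
    (hγ0 : 0 ≤ γ) (hγ1 : γ ≤ 1) (hU : Differentiable ℝ U)
    (hG : ∀ x, x ≠ 0 → DifferentiableAt ℝ G x)
    (hGodd : ∀ x, x ≠ 0 → gradient G (-x) = -gradient G x)
    (hUgrad : ∀ x : EuclideanSpace ℝ (Fin d), ‖gradient U x‖ ≤ a₁ * (1 + ‖x‖ ^ lam))
    (hUcoer : ∀ x : EuclideanSpace ℝ (Fin d), a₂ * ‖x‖ ^ (lam + 1) - a₃ ≤ ⟪gradient U x, x⟫)
    (hGforce : ∀ x : EuclideanSpace ℝ (Fin d), x ≠ 0 →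
      ‖gradient G x + a₄ • pairForce (γ + 2) x‖ ≤ C * (1 + ‖x‖ ^ (-γ)))
    {q : Fin N → EuclideanSpace ℝ (Fin d)} (hq : Function.Injective q)
    (hKq : (1 + ∑ i, ‖q i‖) * ∑ i, (1 + ‖q i‖ ^ lam) ≤ K * (1 + ∑ i, ‖q i‖ ^ (lam + 1)))
    (p : Fin N → EuclideanSpace ℝ (Fin d)) {H ξ z r y D S : ℝ} (hH0 : 1 ≤ H)
    (hH : HN ε U G q p = H) (hHp : ∀ i, Real.sqrt (1 + ε * ‖p i‖ ^ 2) ≤ H)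
    (hξ : Real.sqrt ε * ∑ i, ‖q i‖ = ξ)
    (hz : ε * pairSum (fun i j => ‖q i - q j‖ ^ (-γ)) = z)
    (hr : ε ^ 2 * pairSum (fun i j => (‖q i - q j‖ ^ (-γ)) ^ 2) = r)
    (hy : ε * ∑ i, ‖q i‖ ^ (lam + 1) = y)
    (hD : ε * ∑ i, ‖velocity ε p i‖ ^ 2 = D)
    (hS : ∑ i, Real.sqrt (1 + ε * ‖p i‖ ^ 2) = S) :
    LN ε U G (lyapunov A₁ A₂ γ ε U G) q p ≤
      3 * A₁ * H ^ 2 * (-D + ε * d * N) + N * (d + 2) * (ξ * H) + 6 * A₁ * N * H + 2 * ξ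
        + (H ^ 2 * D + H * ξ - a₂ * H * y + a₃ * N * H
          + (a₄ + 2 * C) * (N : ℝ) ^ 2 * H * (1 + z + ξ))
        + A₂ * (4 * (S * z) + 2 * (N : ℝ) ^ 2 * (1 + ξ) + N * a₁ * K * (1 + y) - 2 * a₄ * r
          + 2 * C * (N : ℝ) ^ 3 * ((1 + z) * (1 + ξ))) := by
  obtain ⟨M, hM, hL⟩ := LN_lyapunov_eq (p := p) (A₁ := A₁) (A₂ := A₂) hε hU hG hGodd hq hγ0 hγ1
  have hX0 : 0 ≤ ∑ i, ‖q i‖ := by positivity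
  have hξ0 : 0 ≤ ξ := by rw [← hξ]; positivity
  have hNd : 0 ≤ (N : ℝ) * (d + 2) := by positivity
  have g1 := generatorHN_le hε p
  have g2 := abs_generatorHN_le hε hε1 p
  have g3 := mul_abs_sum_inner_le hε q p hHp
  have g4 := mul_sum_norm_velocity_sq_le hε p
  have g5 := sqrt_mul_abs_sum_inner_velocity_le hε q p
  have g6 := mul_sum_inner_velocity_le hε p hHp
  have g7 := mul_sum_inner_momentumDrift_le hε hε1 ha₃ ha₄ hC hN hγ0 hγ1 hGodd hUcoer hGforce hq p
  have g8 := mul_abs_le_sum_sqrt_mul_pairSum hε q p hM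
  have g9 := neg_mul_pairVirial_momentumDrift_le hε hε1 ha₁ ha₄ hC hK hN hγ0 hγ1 hUgrad hGforce
    hq hKq p
  have hcomm : ∑ i, ⟪velocity ε p i, q i⟫ = ∑ i, ⟪q i, velocity ε p i⟫ :=
    Finset.sum_congr rfl fun i _ => real_inner_comm _ _
  rw [hcomm] at hL
  rw [hξ] at g3 g7 g9
  rw [hz, hy] at g7
  rw [hz, hr, hy] at g9
  rw [hD] at g1 g4 g6
  rw [hS] at g8
  rw [hH] at hL
  have t1 : 3 * A₁ * H ^ 2 * generatorHN ε p ≤ 3 * A₁ * H ^ 2 * (-D + ε * d * N) :=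
    mul_le_mul_of_nonneg_left g1 (by positivity)
  have t2 : ε * (∑ i, ⟪q i, p i⟫) * generatorHN ε p ≤ N * (d + 2) * (ξ * H) := by
    refine (le_abs_self _).trans ?_
    rw [abs_mul, abs_mul, abs_of_pos hε, mul_comm]
    exact mul_le_mul g2 g3 (by positivity) hNd
  have t3 : 6 * A₁ * H * ε ^ 2 * ∑ i, ‖velocity ε p i‖ ^ 2 ≤ 6 * A₁ * N * H := by
    calc 6 * A₁ * H * ε ^ 2 * ∑ i, ‖velocity ε p i‖ ^ 2 = 6 * A₁ * H * (ε * D) := by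
          rw [← hD]; ring
      _ ≤ 6 * A₁ * H * N := by
          have hD0 : 0 ≤ D := by rw [← hD]; positivity
          have : ε * D ≤ N := by nlinarith
          gcongr
      _ = _ := by ring
  have t4 : 2 * ε ^ 2 * ∑ i, ⟪q i, velocity ε p i⟫ ≤ 2 * ξ := by
    have hs := Real.sqrt_nonneg ε
    have h1 := mul_le_mul_of_nonneg_left g5 hs
    rw [hξ, ← mul_assoc, Real.mul_self_sqrt hε.le] at h1
    have h2 := mul_le_mul_of_nonneg_left (le_abs_self (∑ i, ⟪q i, velocity ε p i⟫)) hε.le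
    nlinarith
  have t5 : ε * H * (∑ i, ⟪velocity ε p i, p i⟫ + ∑ i, ⟪q i, momentumDrift ε U G q p i⟫)
      ≤ H * (H * D + (ξ - a₂ * y + a₃ * N + (a₄ + 2 * C) * (N : ℝ) ^ 2 * (1 + z + ξ))) := by
    calc ε * H * (∑ i, ⟪velocity ε p i, p i⟫ + ∑ i, ⟪q i, momentumDrift ε U G q p i⟫)
        = H * (ε * ∑ i, ⟪velocity ε p i, p i⟫ + ε * ∑ i, ⟪q i, momentumDrift ε U G q p i⟫) := by
          ring
      _ ≤ _ := mul_le_mul_of_nonneg_left (add_le_add g6 g7) (by linarith)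
  have t6 : -(ε ^ 2 * M) ≤ 4 * (S * z) := by
    calc -(ε ^ 2 * M) = ε * (ε * -M) := by ring
      _ ≤ ε * (ε * |M|) := by gcongr; exact neg_le_abs M
      _ ≤ ε * (4 * (S * pairSum (fun i j => ‖q i - q j‖ ^ (-γ)))) := by gcongr
      _ = 4 * (S * z) := by rw [← hz]; ring
  have t7 := mul_le_mul_of_nonneg_left (add_le_add t6 g9) hA₂
  rw [hL]
  linarith

/-- Inequality (3.22) in the proof of Lemma 3.2: under Assumptions (U), (G1), (G2) and
the normalization, there exist `A₁, A₂, c₁ > 0` and `ε₀ ∈ (0,1)` such that for every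
`ε ∈ (0,ε₀)` there is `C₂ > 0` with
`L_N(A₁H_N³ + εH_N⟨q,p⟩ − A₂ε²∑_{i<j}⟨pᵢ−pⱼ,(qᵢ−qⱼ)/|qᵢ−qⱼ|^{β₁−1}⟩) ≤ −c₁H_N² + C₂`
on `X`. -/
theorem stmt_14 (d N : ℕ) (hd : 1 ≤ d) (hN : 2 ≤ N)
    (U G : EuclideanSpace ℝ (Fin d) → ℝ)
    (a₁ lam a₂ a₃ β₁ β₂ a₄ a₅ a₆ : ℝ)
    (ha₁ : 0 < a₁) (hlam : 1 ≤ lam) (ha₂ : 0 < a₂) (ha₃ : 0 < a₃)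
    (hβ₁ : 1 ≤ β₁) (hβ₂0 : 0 ≤ β₂) (hβ₂1 : β₂ < β₁) (ha₄ : 0 < a₄) (ha₆ : 0 < a₆)
    (hUsmooth : ContDiff ℝ (⊤ : ℕ∞) U)
    (hUone : ∀ q, 1 ≤ U q)
    (hUlow : ∀ q : EuclideanSpace ℝ (Fin d), (1 / a₁) * ‖q‖ ^ (lam + 1) - a₁ ≤ U q)
    (hUup : ∀ q : EuclideanSpace ℝ (Fin d), U q ≤ a₁ * (1 + ‖q‖ ^ (lam + 1)))
    (hUgrad : ∀ q : EuclideanSpace ℝ (Fin d), ‖gradient U q‖ ≤ a₁ * (1 + ‖q‖ ^ lam))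
    (hUcoer : ∀ q : EuclideanSpace ℝ (Fin d), a₂ * ‖q‖ ^ (lam + 1) - a₃ ≤ ⟪gradient U q, q⟫)
    (hGsmooth : ContDiffOn ℝ (⊤ : ℕ∞) G {(0 : EuclideanSpace ℝ (Fin d))}ᶜ)
    (hGblow : Filter.Tendsto G (nhdsWithin 0 {(0 : EuclideanSpace ℝ (Fin d))}ᶜ) Filter.atTop)
    (hGeven : ∀ q, G (-q) = G q)
    (hGodd : ∀ q : EuclideanSpace ℝ (Fin d), q ≠ 0 → gradient G (-q) = -gradient G q)
    (hGbd : ∀ q : EuclideanSpace ℝ (Fin d), q ≠ 0 →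
      |G q| ≤ a₁ * (1 + ‖q‖ + ‖q‖ ^ (-β₁)))
    (hGgradbd : ∀ q : EuclideanSpace ℝ (Fin d), q ≠ 0 →
      ‖gradient G q‖ ≤ a₁ * (1 + ‖q‖ ^ (-β₁)))
    (hGstruct : ∀ q : EuclideanSpace ℝ (Fin d), q ≠ 0 →
      ‖gradient G q + (a₄ / ‖q‖ ^ (β₁ + 1)) • q + (a₅ / ‖q‖ ^ (β₂ + 1)) • q‖ ≤ a₆)
    (hG2a : 1 < β₁) (hG2b : β₁ ≤ 2) (hG2c : β₂ < β₁ - 1)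
    (hNorm : ∀ q : Fin N → EuclideanSpace ℝ (Fin d), Function.Injective q →
      1 ≤ ∑ i, U (q i) +
          ∑ i : Fin N, ∑ j ∈ Finset.univ.filter (fun j => i < j), G (q i - q j)) :
    ∃ A₁ A₂ c₁ ε₀ : ℝ, 0 < A₁ ∧ 0 < A₂ ∧ 0 < c₁ ∧ ε₀ ∈ Set.Ioo (0 : ℝ) 1 ∧
      ∀ ε : ℝ, ε ∈ Set.Ioo (0 : ℝ) ε₀ →
        ∃ C₂ : ℝ, 0 < C₂ ∧
          ∀ q : Fin N → EuclideanSpace ℝ (Fin d), Function.Injective q →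
            ∀ p : Fin N → EuclideanSpace ℝ (Fin d),
              LN ε U G
                  (fun q' p' =>
                    A₁ * (HN ε U G q' p') ^ 3
                      + ε * HN ε U G q' p' * (∑ i, ⟪q' i, p' i⟫)
                      - A₂ * ε ^ 2 *
                          ∑ i : Fin N, ∑ j ∈ Finset.univ.filter (fun j => i < j),
                            ⟪p' i - p' j, (‖q' i - q' j‖ ^ (β₁ - 1))⁻¹ • (q' i - q' j)⟫)
                  q p
                ≤ -c₁ * (HN ε U G q p) ^ 2 + C₂ := by
  obtain ⟨γ, rfl⟩ : ∃ γ, β₁ = γ + 1 := ⟨β₁ - 1, by ring⟩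
  have hγ0 : 0 < γ := by linarith
  have hγ1 : γ ≤ 1 := by linarith
  have hN0 : 0 < N := by omega
  have hN1 : (1 : ℝ) ≤ N := by exact_mod_cast hN0
  have hUd : Differentiable ℝ U := hUsmooth.differentiable (by simp)
  have hGd : ∀ x, x ≠ 0 → DifferentiableAt ℝ G x := fun x hx =>
    (hGsmooth.contDiffAt (isOpen_compl_singleton.mem_nhds hx)).differentiableAt (by simp)
  obtain ⟨Cm, hCm, hGlow⟩ := exists_neg_mul_le_of_tendsto_atTop ha₁ (by linarith) hGblow hGbd
  have hGup := le_of_norm_gradient_le ha₁ hγ0 hGd hGbd hGgradbd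
  obtain ⟨C, hC, hGforce⟩ := exists_norm_gradient_add_pairForce_le ha₆.le hβ₂0
    (by linarith : β₂ ≤ γ) (fun x hx => by
      have h := hGstruct x hx
      rwa [show γ + 1 + 1 = γ + 2 by ring] at h)
  obtain ⟨K, hK, hKq⟩ := exists_one_add_sum_mul_le (d := d) hlam hN0
  obtain ⟨CY, hCY, hY⟩ := exists_mul_sum_rpow_le_HN ha₁ hlam hCm hN0 hUlow hGlow
  obtain ⟨A₁, A₂, c₁, ε₀, C₂, hA₁, hA₂, hc₁, hε₀, hε₀1, hC₂, hmain⟩ :=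
    exists_lyapunov_constants (a₁ := a₁) (a₂ := a₂) (a₃ := a₃) (a₄ := a₄)
      (C₅ := (a₄ + 2 * C) * (N : ℝ) ^ 2) (C₇ := 2 * C * (N : ℝ) ^ 3)
      (C₈ := (3 * a₁ + 2 * a₁ / γ) * (N : ℝ) ^ 2) (CU := N * a₁ * K) (CY := CY)
      (Cξ := N * (N + CY)) (n := N) (δ := d) ha₁ ha₂ ha₄ (by positivity) (by positivity)
      (by positivity) (by positivity) hN1 (by positivity)
  refine ⟨A₁, A₂, c₁, ε₀, hA₁, hA₂, hc₁, ⟨hε₀, hε₀1⟩, fun ε hε => ⟨C₂, hC₂, fun q hq p => ?_⟩⟩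
  have hε1 : ε ≤ 1 := (hε.2.trans hε₀1).le
  have hHS : ∑ i, Real.sqrt (1 + ε * ‖p i‖ ^ 2) ≤ HN ε U G q p := by
    have h := mul_nonneg hε.1.le (zero_le_one.trans (hNorm q hq))
    unfold HN
    linarith
  have hHp : ∀ i, Real.sqrt (1 + ε * ‖p i‖ ^ 2) ≤ HN ε U G q p := fun i =>
    (Finset.single_le_sum (f := fun i => Real.sqrt (1 + ε * ‖p i‖ ^ 2))
      (fun i _ => Real.sqrt_nonneg _) (Finset.mem_univ i)).trans hHS
  have hH0 : 1 ≤ HN ε U G q p := (one_le_sqrt_one_add hε.1 (p ⟨0, hN0⟩)).trans (hHp _)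
  have hYH := hY ε hε.1 hε1 q p hq hH0
  have hL := LN_lyapunov_le hε.1 hε1 hA₁.le hA₂.le ha₁.le ha₃.le ha₄.le hC hK hN0 hγ0.le hγ1 hUd
    hGd hGodd hUgrad hUcoer hGforce hq (hKq q) p hH0 rfl hHp rfl rfl rfl rfl rfl rfl
  have hfun : (fun q' p' => A₁ * (HN ε U G q' p') ^ 3
      + ε * HN ε U G q' p' * (∑ i, ⟪q' i, p' i⟫)
      - A₂ * ε ^ 2 * ∑ i : Fin N, ∑ j ∈ Finset.univ.filter (fun j => i < j),
        ⟪p' i - p' j, (‖q' i - q' j‖ ^ (γ + 1 - 1))⁻¹ • (q' i - q' j)⟫)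
      = lyapunov A₁ A₂ γ ε U G := by
    rw [add_sub_cancel_right]
    rfl
  rw [hfun]
  refine hmain ε _ _ _ _ _ _ _ _ hε.1 hε.2 hH0 (by positivity)
    (mul_nonneg hε.1.le (pairSum_nonneg fun i j _ => by positivity))
    (mul_nonneg hε.1.le (by positivity))
    (HN_le ha₁.le (by positivity) hN0 hε.1 hε1 hUup hGup hq) (sum_sqrt_one_add_le hε.1 p hHp)
    (sum_sqrt_one_add_sq_le hε.1 p hHp) ?_ ?_ hYH hL
  · rw [mul_pow, Real.sq_sqrt hε.1.le]
    calc ε * (∑ i, ‖q i‖) ^ 2 ≤ ε * (N * (N + ∑ i, ‖q i‖ ^ (lam + 1))) :=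
          mul_le_mul_of_nonneg_left (sum_norm_sq_le hlam q) hε.1.le
      _ = N * (N * ε + ε * ∑ i, ‖q i‖ ^ (lam + 1)) := by ring
      _ ≤ N * (N * HN ε U G q p + CY * HN ε U G q p) := by
          gcongr
          exact hε1.trans hH0
      _ = _ := by ring
  · rw [mul_pow]
    calc ε ^ 2 * pairSum (fun i j => ‖q i - q j‖ ^ (-γ)) ^ 2
        ≤ ε ^ 2 * ((N : ℝ) ^ 2 * pairSum (fun i j => (‖q i - q j‖ ^ (-γ)) ^ 2)) := by
          gcongr
          exact pairSum_sq_le hN0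
      _ = _ := by ring
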